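/- arXiv:1605.00903 — 4 statements merged into one kernel-verified Lean document; each statement's English description precedes it below -/
import Mathlib

section
/- There exist absolute constants C, c > 0 such that for every even q with 2 ≤ q ≤ n, the following holds with probability at least 1 − n^{−c} over a random q-tensor A with i.i.d. entries uniform on {−1,+1}: the quotient matrix Â_Q of the multilinear averaged matrix 𝖠 satisfies ‖Â_Q‖₂ ≤ C^q · n^{q/4} / q^{q/4}. -/
open scoped BigOperators

noncomputable section

/-- The ±1-valued tensor associated with a Boolean sign pattern. -/
def signT {n d : ℕ} (A : (Fin d → Fin n) → Bool) : (Fin d → Fin n) → ℝ :=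
  fun K => if A K then 1 else -1

/-- Expectation of `g` over a random order-`d` tensor with i.i.d. uniform ±1 entries. -/
def texp (n d : ℕ) (g : ((Fin d → Fin n) → ℝ) → ℝ) : ℝ :=
  (∑ A : (Fin d → Fin n) → Bool, g (signT A)) / (Fintype.card ((Fin d → Fin n) → Bool) : ℝ)

/-- Probability of event `P` over a random order-`d` tensor with i.i.d. uniform ±1 entries. -/
def tprob (n d : ℕ) (P : ((Fin d → Fin n) → ℝ) → Prop) : ℝ :=
  (Nat.card {A : (Fin d → Fin n) → Bool // P (signT A)} : ℝ) /
    (Fintype.card ((Fin d → Fin n) → Bool) : ℝ)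

/-- Operator (ℓ₂→ℓ₂) norm of a rectangular array, as the sup of `|uᵀ M v|` over unit vectors. -/
def opNorm {ι κ : Type*} [Fintype ι] [Fintype κ] (M : ι → κ → ℝ) : ℝ :=
  sSup {r : ℝ | ∃ (u : EuclideanSpace ℝ ι) (v : EuclideanSpace ℝ κ),
    ‖u‖ = 1 ∧ ‖v‖ = 1 ∧ r = |∑ i, ∑ j, u i * M i j * v j|}

/-- Largest eigenvalue of a symmetric array, as the sup of Rayleigh quotients. -/
def lamMax {ι : Type*} [Fintype ι] (M : ι → ι → ℝ) : ℝ :=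
  sSup {r : ℝ | ∃ y : EuclideanSpace ℝ ι, ‖y‖ = 1 ∧ r = ∑ i, ∑ j, y i * M i j * y j}

/-- Number of occurrences of `v` among the coordinates of the tuple `I`. -/
def cnt {n k : ℕ} (I : Fin k → Fin n) (v : Fin n) : ℕ :=
  (Finset.univ.filter fun ℓ => I ℓ = v).card

/-- The set `O(δ)` of tuples whose multi-index is `δ`. -/
def Oset (n k : ℕ) (δ : Fin n → ℕ) : Finset (Fin k → Fin n) :=
  Finset.univ.filter fun K => ∀ v, cnt K v = δ v

/-- The set of elements of `[n]` occurring among the coordinates of `I¹, …, Iᵖ`. -/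
def occSet {n h p : ℕ} (I : Fin p → Fin h → Fin n) : Finset (Fin n) :=
  Finset.univ.filter fun v => ∃ ℓ j, I ℓ j = v

/-- Membership in the class `𝒞(c¹,…,cˢ)`: there are exactly `s` distinct occurring
elements and the `k`-th smallest occurring element appears `c k ℓ` times in `Iˡ`. -/
def inC {n h p s : ℕ} (c : Fin s → Fin p → ℕ) (I : Fin p → Fin h → Fin n) : Prop :=
  ∃ hcard : (occSet I).card = s,
    ∀ (k : Fin s) (ℓ : Fin p),
      cnt (I ℓ) (((occSet I).orderIsoOfFin hcard k : Fin n)) = c k ℓ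

/-- Concatenation of two half-tuples of length `d/2` into a tuple of length `d` (`d` even). -/
def halfConcat {n : ℕ} (d : ℕ) (hd : d % 2 = 0) (K₁ K₂ : Fin (d / 2) → Fin n) :
    Fin d → Fin n :=
  fun t => if h : (t : ℕ) < d / 2 then K₁ ⟨t, h⟩
           else K₂ ⟨(t : ℕ) - d / 2, by have ht := t.isLt; omega⟩

/-- The position in `[q/2]` of the `r`-th entry of the `m`-th block of length `d/2`. -/
def blockIdx (d q : ℕ) (m : Fin (q / d)) (r : Fin (d / 2)) : Fin (q / 2) :=
  ⟨(m : ℕ) * (d / 2) + (r : ℕ), by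
    have hm : (m : ℕ) < q / d := m.isLt
    have hr : (r : ℕ) < d / 2 := r.isLt
    have h3 : q / d * (d / 2) ≤ q / 2 := by
      have h4 : q / d * d ≤ q := Nat.div_mul_le_self q d
      have h6 : q / d * (d / 2) * 2 ≤ q / d * d := by
        have h5 : d / 2 * 2 ≤ d := by omega
        calc q / d * (d / 2) * 2 = q / d * (d / 2 * 2) := by ring
          _ ≤ q / d * d := Nat.mul_le_mul (le_refl _) h5
      omega
    have h7 : ((m : ℕ) + 1) * (d / 2) ≤ q / d * (d / 2) :=
      Nat.mul_le_mul (by omega) (le_refl _)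
    have h8 : ((m : ℕ) + 1) * (d / 2) = (m : ℕ) * (d / 2) + d / 2 := by ring
    omega⟩

/-- Row-column independent symmetrization of `A^{⊗ q/d}`. -/
def rcSym (n d q : ℕ) (hd : d % 2 = 0) (A : (Fin d → Fin n) → ℝ)
    (I J : Fin (q / 2) → Fin n) : ℝ :=
  ((Nat.factorial (q / 2) : ℝ))⁻¹ ^ 2 *
    ∑ π : Equiv.Perm (Fin (q / 2)), ∑ σ : Equiv.Perm (Fin (q / 2)),
      ∏ m : Fin (q / d),
        A (halfConcat d hd (fun r => I (π (blockIdx d q m r)))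
            (fun r => J (σ (blockIdx d q m r))))

/-- `E(I¹,…,Iᵖ) = 𝔼[∏_ℓ M[Iˡ, Iˡ⁺¹]]` (cyclically). -/
def Efun (n d q p : ℕ) (hd : d % 2 = 0) (hp : p ≠ 0)
    (I : Fin p → Fin (q / 2) → Fin n) : ℝ :=
  haveI : NeZero p := ⟨hp⟩
  texp n d fun A => ∏ ℓ : Fin p, rcSym n d q hd A (I ℓ) (I (ℓ + 1))

/-- `Tr(M^p)` for the row-column independent symmetrization `M` of `A^{⊗ q/d}`. -/
def trMpow (n d q p : ℕ) (hd : d % 2 = 0) (hp : p ≠ 0)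
    (A : (Fin d → Fin n) → ℝ) : ℝ :=
  haveI : NeZero p := ⟨hp⟩
  ∑ I : Fin p → Fin (q / 2) → Fin n, ∏ ℓ : Fin p, rcSym n d q hd A (I ℓ) (I (ℓ + 1))

/-- `𝒯 = Σ_ℓ T_ℓ ⊗ T_ℓ`, where `T_ℓ` is the symmetrized `ℓ`-th slice of the 3-tensor `A`. -/
def calT (n : ℕ) (A : (Fin 3 → Fin n) → ℝ) (u v : Fin n × Fin n) : ℝ :=
  ∑ ℓ : Fin n,
    ((A ![ℓ, u.1, v.1] + A ![ℓ, v.1, u.1]) / 2) *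
    ((A ![ℓ, u.2, v.2] + A ![ℓ, v.2, u.2]) / 2)

/-- `T = 𝒯 - D`, where `D` is the restriction of `𝒯` to entries `[(i,i),(j,j)]`. -/
def Tmat (n : ℕ) (A : (Fin 3 → Fin n) → ℝ) (u v : Fin n × Fin n) : ℝ :=
  calT n A u v - (if u.1 = u.2 ∧ v.1 = v.2 then calT n A u v else 0)

/-- The position in `[q/2]` of the `r`-th entry of the `g`-th pair. -/
def pairIdx (q : ℕ) (g : Fin (q / 4)) (r : Fin 2) : Fin (q / 2) :=
  ⟨2 * (g : ℕ) + (r : ℕ), by have hg := g.isLt; have hr := r.isLt; omega⟩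

/-- `𝖠 = T^{⊗ q/4}` as a `[n]^{q/2} × [n]^{q/2}` array. -/
def bigA3 (n q : ℕ) (A : (Fin 3 → Fin n) → ℝ) (I J : Fin (q / 2) → Fin n) : ℝ :=
  ∏ g : Fin (q / 4),
    Tmat n A (I (pairIdx q g 0), I (pairIdx q g 1)) (J (pairIdx q g 0), J (pairIdx q g 1))

/-- The row-column symmetrized matrix `B`. -/
def Bmat (n q : ℕ) (A : (Fin 3 → Fin n) → ℝ) (I J : Fin (q / 2) → Fin n) : ℝ :=
  ((Nat.factorial (q / 2) : ℝ))⁻¹ ^ 2 *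
    ∑ π : Equiv.Perm (Fin (q / 2)), ∑ σ : Equiv.Perm (Fin (q / 2)),
      bigA3 n q A (fun t => I (π t)) (fun t => J (σ t))

/-- `E(I¹,…,Iᵖ) = 𝔼[∏_ℓ B[Iˡ, Iˡ⁺¹]]` (cyclically), for the 3-tensor case. -/
def E3fun (n q p : ℕ) (hp : p ≠ 0) (I : Fin p → Fin (q / 2) → Fin n) : ℝ :=
  haveI : NeZero p := ⟨hp⟩
  texp n 3 fun A => ∏ ℓ : Fin p, Bmat n q A (I ℓ) (I (ℓ + 1))

/-- Concatenation of two tuples of length `q/2` into a tuple of length `q` (`q` even). -/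
def tupConcat {n : ℕ} (q : ℕ) (hq : q % 2 = 0) (I J : Fin (q / 2) → Fin n) :
    Fin q → Fin n :=
  fun t => if h : (t : ℕ) < q / 2 then I ⟨t, h⟩
           else J ⟨(t : ℕ) - q / 2, by have ht := t.isLt; omega⟩

end


lemma mgf_signs {κ : Type*} [Fintype κ] [DecidableEq κ] (a : κ → ℝ) (l : ℝ) :
    ∑ A : κ → Bool, Real.exp (l * ∑ K, a K * (if A K then (1:ℝ) else -1)) ≤
      2 ^ Fintype.card κ * Real.exp (l ^ 2 * (∑ K, a K ^ 2) / 2) := by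
  have h1 : ∀ A : κ → Bool, Real.exp (l * ∑ K, a K * (if A K then (1:ℝ) else -1)) =
      ∏ K, Real.exp (l * (a K * (if A K then (1:ℝ) else -1))) := by
    intro A
    rw [Finset.mul_sum, Real.exp_sum]
  simp_rw [h1]
  have h2 := (Finset.prod_univ_sum (fun _ : κ => (Finset.univ : Finset Bool))
    (fun K b => Real.exp (l * (a K * (if b then (1:ℝ) else -1)))))
  rw [Fintype.piFinset_univ] at h2
  rw [← h2]
  have h3 : ∀ K, ∑ b : Bool, Real.exp (l * (a K * (if b then (1:ℝ) else -1))) ≤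
      2 * Real.exp ((l * a K) ^ 2 / 2) := by
    intro K
    have := Real.cosh_le_exp_half_sq (l * a K)
    rw [Real.cosh_eq] at this
    simp
    linarith
  calc _ ≤ ∏ K, (2 * Real.exp ((l * a K) ^ 2 / 2)) :=
        Finset.prod_le_prod (fun K _ => Finset.sum_nonneg fun b _ => (Real.exp_pos _).le)
          (fun K _ => h3 K)
    _ = _ := by
        rw [Finset.prod_mul_distrib, ← Real.exp_sum]
        simp only [Finset.prod_const, Finset.card_univ]
        congr 2
        rw [Finset.mul_sum, Finset.sum_div]
        exact Finset.sum_congr rfl fun K _ => by ring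

lemma tail_one {κ : Type*} [Fintype κ] [DecidableEq κ] (a : κ → ℝ) (s t : ℝ) (hs : 0 < s)
    (ht : 0 ≤ t) (ha : ∑ K, a K ^ 2 ≤ s) :
    ((Finset.univ.filter fun A : κ → Bool =>
      t < ∑ K, a K * (if A K then (1:ℝ) else -1)).card : ℝ) ≤
      2 ^ Fintype.card κ * Real.exp (-(t ^ 2 / (2 * s))) := by
  have hm := mgf_signs a (t / s)
  set F := Finset.univ.filter fun A : κ → Bool =>
      t < ∑ K, a K * (if A K then (1:ℝ) else -1) with hF
  have h1 : (F.card : ℝ) * Real.exp (t / s * t) ≤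
      ∑ A : κ → Bool, Real.exp (t / s * ∑ K, a K * (if A K then (1:ℝ) else -1)) := by
    rw [← nsmul_eq_mul, ← Finset.sum_const]
    refine (Finset.sum_le_sum ?_).trans (Finset.sum_le_sum_of_subset_of_nonneg
      (Finset.filter_subset _ _) (fun _ _ _ => (Real.exp_pos _).le))
    intro A hA
    have := (Finset.mem_filter.1 hA).2
    apply Real.exp_le_exp.2
    have : 0 ≤ t / s := by positivity
    gcongr
  have h2 : Real.exp ((t / s) ^ 2 * (∑ K, a K ^ 2) / 2) ≤ Real.exp (t ^ 2 / (2 * s)) := by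
    apply Real.exp_le_exp.2
    calc _ ≤ (t / s) ^ 2 * s / 2 := by gcongr
      _ = _ := by field_simp
  have h3 : (F.card : ℝ) * Real.exp (t / s * t) ≤
      2 ^ Fintype.card κ * Real.exp (t ^ 2 / (2 * s)) :=
    h1.trans (hm.trans (by gcongr))
  have h4 : Real.exp (-(t ^ 2 / (2 * s))) * Real.exp (t / s * t) = Real.exp (t ^ 2 / (2 * s)) := by
    rw [← Real.exp_add]; congr 1; field_simp; ring
  rw [← h4, ← mul_assoc] at h3
  exact le_of_mul_le_mul_right h3 (Real.exp_pos _)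

lemma tail_two {κ : Type*} [Fintype κ] [DecidableEq κ] (a : κ → ℝ) (s t : ℝ) (hs : 0 < s)
    (ht : 0 ≤ t) (ha : ∑ K, a K ^ 2 ≤ s) :
    ((Finset.univ.filter fun A : κ → Bool =>
      t < |∑ K, a K * (if A K then (1:ℝ) else -1)|).card : ℝ) ≤
      2 * (2 ^ Fintype.card κ * Real.exp (-(t ^ 2 / (2 * s)))) := by
  have h1 := tail_one a s t hs ht ha
  have h2 := tail_one (fun K => - a K) s t hs ht (by simpa using ha)
  have h3 : (Finset.univ.filter fun A : κ → Bool =>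
      t < |∑ K, a K * (if A K then (1:ℝ) else -1)|) ⊆
      (Finset.univ.filter fun A : κ → Bool => t < ∑ K, a K * (if A K then (1:ℝ) else -1)) ∪
      (Finset.univ.filter fun A : κ → Bool => t < ∑ K, (- a K) * (if A K then (1:ℝ) else -1)) := by
    intro A hA
    have hA := (Finset.mem_filter.1 hA).2
    simp only [Finset.mem_union, Finset.mem_filter, Finset.mem_univ, true_and, neg_mul,
      Finset.sum_neg_distrib]
    exact lt_abs.1 hA
  have h4 := (Finset.card_le_card h3).trans (Finset.card_union_le _ _)
  have h5 : ((Finset.univ.filter fun A : κ → Bool =>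
      t < |∑ K, a K * (if A K then (1:ℝ) else -1)|).card : ℝ) ≤ _ := Nat.cast_le.2 h4
  push_cast at h5
  linarith

lemma exists_net (ι : Type*) [Fintype ι] : ∃ s : Finset (EuclideanSpace ℝ ι),
    s.card ≤ 5 ^ Fintype.card ι ∧ (∀ u ∈ s, ‖u‖ = 1) ∧
    ∀ u : EuclideanSpace ℝ ι, ‖u‖ = 1 → ∃ v ∈ s, ‖u - v‖ ≤ 1 / 2 := by
  classical
  let P : Finset (EuclideanSpace ℝ ι) → Prop := fun s => (∀ u ∈ s, ‖u‖ = 1) ∧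
    ∀ u ∈ s, ∀ v ∈ s, u ≠ v → 1 / 2 ≤ ‖u - v‖
  have hcard : ∀ s, P s → s.card ≤ 5 ^ Fintype.card ι := by
    intro s hs
    have := Besicovitch.card_le_of_separated (s.image fun u => (2:ℝ) • u) ?_ ?_
    · rw [Finset.card_image_of_injective _ (smul_right_injective _ two_ne_zero)] at this
      simpa using this
    · intro c hc
      obtain ⟨u, hu, rfl⟩ := Finset.mem_image.1 hc
      simp [norm_smul, hs.1 u hu]
    · intro c hc d hd hne
      obtain ⟨u, hu, rfl⟩ := Finset.mem_image.1 hc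
      obtain ⟨v, hv, rfl⟩ := Finset.mem_image.1 hd
      have := hs.2 u hu v hv (fun h => hne (by rw [h]))
      rw [← smul_sub, norm_smul]
      norm_num
      linarith
  by_contra hcon
  have hk : ∀ k : ℕ, ∃ s, P s ∧ s.card = k := by
    intro k
    induction k with
    | zero => exact ⟨∅, by simp [P], rfl⟩
    | succ k ih =>
      obtain ⟨s, hs, hsk⟩ := ih
      have : ∃ u : EuclideanSpace ℝ ι, ‖u‖ = 1 ∧ ∀ v ∈ s, 1 / 2 < ‖u - v‖ := by
        by_contra hno
        push Not at hno
        exact hcon ⟨s, hcard s hs, hs.1, hno⟩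
      obtain ⟨u, hu, huv⟩ := this
      have hus : u ∉ s := fun h => by
        have := huv u h
        simp at this
        linarith
      refine ⟨insert u s, ⟨?_, ?_⟩, by rw [Finset.card_insert_of_notMem hus, hsk]⟩
      · intro w hw
        rcases Finset.mem_insert.1 hw with rfl | hw
        · exact hu
        · exact hs.1 w hw
      · intro x hx y hy hne
        rcases Finset.mem_insert.1 hx with hx1 | hx1 <;> rcases Finset.mem_insert.1 hy with hy1 | hy1
        · exact absurd (hx1.trans hy1.symm) hne
        · rw [hx1]; exact (huv y hy1).le
        · rw [hy1, norm_sub_rev]; exact (huv x hx1).le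
        · exact hs.2 x hx1 y hy1 hne
  obtain ⟨s, hs, hsk⟩ := hk (5 ^ Fintype.card ι + 1)
  have := hcard s hs
  omega

lemma norm_le_of_net {E : Type*} [NormedAddCommGroup E] [InnerProductSpace ℝ E] (s : Set E)
    (hs : ∀ u : E, ‖u‖ = 1 → ∃ v ∈ s, ‖u - v‖ ≤ 1 / 2) (t : ℝ) (ht : 0 ≤ t) (w : E)
    (h : ∀ v ∈ s, |inner ℝ v w| ≤ t) : ‖w‖ ≤ 2 * t := by
  by_cases hw : w = 0
  · simp [hw, ht]
  have hw' : ‖w‖ ≠ 0 := norm_ne_zero_iff.2 hw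
  obtain ⟨v, hv, huv⟩ := hs (‖w‖⁻¹ • w) (by rw [norm_smul]; simp [hw'])
  have h1 : inner ℝ (‖w‖⁻¹ • w) w = ‖w‖ := by
    rw [real_inner_smul_left, real_inner_self_eq_norm_sq]; field_simp
  have h2 : inner ℝ (‖w‖⁻¹ • w - v) w ≤ ‖‖w‖⁻¹ • w - v‖ * ‖w‖ := real_inner_le_norm _ _
  rw [inner_sub_left, h1] at h2
  have h3 := (le_abs_self _).trans (h v hv)
  have h4 : ‖‖w‖⁻¹ • w - v‖ * ‖w‖ ≤ 1 / 2 * ‖w‖ := by gcongr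
  linarith

lemma clm_le_of_net {E : Type*} [NormedAddCommGroup E] [InnerProductSpace ℝ E] (s : Set E)
    (hs : ∀ u : E, ‖u‖ = 1 → ∃ v ∈ s, ‖u - v‖ ≤ 1 / 2) (t : ℝ) (ht : 0 ≤ t) (T : E →L[ℝ] E)
    (h : ∀ u ∈ s, ∀ v ∈ s, |inner ℝ u (T v)| ≤ t) : ‖T‖ ≤ 4 * t := by
  have h1 : ∀ v ∈ s, ‖T v‖ ≤ 2 * t := fun v hv =>
    norm_le_of_net s hs t ht _ fun u hu => h u hu v hv
  have h2 : ‖T‖ ≤ 2 * t + ‖T‖ * (1 / 2) := by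
    refine ContinuousLinearMap.opNorm_le_of_unit_norm (by positivity) ?_
    intro v hv
    obtain ⟨v0, hv0, hvv⟩ := hs v hv
    have : T v = T v0 + T (v - v0) := by simp
    rw [this]
    refine (norm_add_le _ _).trans (add_le_add (h1 v0 hv0) ((T.le_opNorm _).trans ?_))
    gcongr
  linarith

lemma bilin_le_of_net {ι : Type*} [Fintype ι] [DecidableEq ι] (s : Set (EuclideanSpace ℝ ι))
    (hs : ∀ u : EuclideanSpace ℝ ι, ‖u‖ = 1 → ∃ v ∈ s, ‖u - v‖ ≤ 1 / 2) (t : ℝ) (ht : 0 ≤ t)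
    (M : ι → ι → ℝ)
    (h : ∀ u ∈ s, ∀ v ∈ s, |∑ i, ∑ j, u i * M i j * v j| ≤ t)
    (u v : EuclideanSpace ℝ ι) (hu : ‖u‖ = 1) (hv : ‖v‖ = 1) :
    |∑ i, ∑ j, u i * M i j * v j| ≤ 4 * t := by
  let T : EuclideanSpace ℝ ι →L[ℝ] EuclideanSpace ℝ ι := Matrix.toEuclideanCLM (𝕜 := ℝ) (Matrix.of M)
  have key : ∀ u v : EuclideanSpace ℝ ι, inner ℝ u (T v) = ∑ i, ∑ j, u i * M i j * v j := by
    intro u v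
    rw [PiLp.inner_apply]
    refine Finset.sum_congr rfl fun i _ => ?_
    have : (T v) i = ∑ j, M i j * v j := by
      simp [T, Matrix.ofLp_toEuclideanCLM, Matrix.mulVec, dotProduct]
    rw [this]
    simp only [RCLike.inner_apply, conj_trivial]
    rw [Finset.sum_mul]
    exact Finset.sum_congr rfl fun j _ => by ring
  have hT := clm_le_of_net s hs t ht T (fun u hu v hv => by rw [key]; exact h u hu v hv)
  rw [← key]
  refine (abs_real_inner_le_norm _ _).trans ?_
  rw [hu, one_mul]
  refine (T.le_opNorm v).trans ?_
  rw [hv, mul_one]; exact hT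

lemma Oset_inj {n k : ℕ} {δ : Fin n → ℕ} (hδ : ∀ v, δ v ≤ 1) {K : Fin k → Fin n}
    (hK : K ∈ Oset n k δ) : Function.Injective K := by
  intro i j hij
  have h1 := (Finset.mem_filter.1 hK).2 (K j)
  have h2 : cnt K (K j) ≤ 1 := h1 ▸ hδ _
  exact Finset.card_le_one.1 h2 i (by simp [hij]) j (by simp)

lemma mem_range_iff_cnt {n k : ℕ} (K : Fin k → Fin n) (v : Fin n) :
    v ∈ Set.range K ↔ cnt K v ≠ 0 := by
  unfold cnt
  rw [Finset.card_ne_zero, Finset.filter_nonempty_iff]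
  simp

lemma Oset_card_le {n k : ℕ} {δ : Fin n → ℕ} (hδ : ∀ v, δ v ≤ 1) :
    (Oset n k δ).card ≤ k.factorial := by
  classical
  rcases (Oset n k δ).eq_empty_or_nonempty with h | ⟨K0, h0⟩
  · simp [h]
  have hsub : Oset n k δ ⊆
      (Finset.univ : Finset (Equiv.Perm (Fin k))).image (fun σ : Equiv.Perm (Fin k) => K0 ∘ (σ : Fin k → Fin k)) := by
    intro K hK
    have hr : Set.range K = Set.range K0 := by
      ext v
      rw [mem_range_iff_cnt, mem_range_iff_cnt, (Finset.mem_filter.1 hK).2 v,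
        (Finset.mem_filter.1 h0).2 v]
    refine Finset.mem_image.2 ⟨((Equiv.ofInjective K (Oset_inj hδ hK)).trans
      (Equiv.setCongr hr)).trans (Equiv.ofInjective K0 (Oset_inj hδ h0)).symm,
      Finset.mem_univ _, ?_⟩
    funext i
    simp [Equiv.apply_ofInjective_symm]
  refine (Finset.card_le_card hsub).trans (Finset.card_image_le.trans ?_)
  simp [Fintype.card_perm]

abbrev MI (n h : ℕ) := {α : Fin n → Fin (h + 1) // ∑ i, ((α i : ℕ)) = h}

/-- number of splittings of a tuple -/
lemma pairs_card_le {n q h : ℕ} (K : Fin q → Fin n) :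
    ((Finset.univ : Finset (MI n h × MI n h)).filter fun p =>
      (∀ v, (p.1.1 v : ℕ) + (p.2.1 v : ℕ) ≤ 1) ∧
      K ∈ Oset n q (fun v => (p.1.1 v : ℕ) + (p.2.1 v : ℕ))).card ≤ 2 ^ q := by
  classical
  have h1 : (Finset.univ : Finset (Finset (Fin q))).card = 2 ^ q := by simp
  rw [← h1]
  refine Finset.card_le_card_of_injOn
    (fun p => Finset.univ.filter fun l => (p.1.1 (K l) : ℕ) = 1) (fun _ _ => by simp) ?_
  rintro p hp p' hp' heq
  simp only [Finset.coe_filter, Finset.mem_univ, true_and, Set.mem_ofPred_eq] at hp hp'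
  obtain ⟨hp1, hp2⟩ := hp
  obtain ⟨hq1, hq2⟩ := hp'
  have c1 := (Finset.mem_filter.1 hp2).2
  have c2 := (Finset.mem_filter.1 hq2).2
  have e1 : ∀ v, (p.1.1 v : ℕ) = (p'.1.1 v : ℕ) := by
    intro v
    by_cases hv : v ∈ Set.range K
    · obtain ⟨l, rfl⟩ := hv
      have := Finset.ext_iff.1 heq l
      simp only [Finset.mem_filter, Finset.mem_univ, true_and] at this
      have a := hp1 (K l)
      have b := hq1 (K l)
      omega
    · rw [mem_range_iff_cnt, not_not] at hv
      have a := c1 v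
      have b := c2 v
      simp only at a b
      omega
  have e2 : ∀ v, (p.2.1 v : ℕ) = (p'.2.1 v : ℕ) := by
    intro v
    have a := c1 v
    have b := c2 v
    have c := e1 v
    simp only at a b
    omega
  refine Prod.ext (Subtype.ext (funext fun v => Fin.ext (e1 v)))
    (Subtype.ext (funext fun v => Fin.ext (e2 v)))

/-- weights -/
noncomputable def wgt (n q h : ℕ) (β γ : MI n h) : ℝ :=
  (if ∀ v, (β.1 v : ℕ) + (γ.1 v : ℕ) ≤ 1 then ((Nat.factorial q : ℝ))⁻¹ else 0) *
    Real.sqrt (((Oset n h (fun v => (β.1 v : ℕ))).card : ℝ) *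
              ((Oset n h (fun v => (γ.1 v : ℕ))).card : ℝ))

lemma wgt_sq_le (n q h : ℕ) (hq : q = h + h) (β γ : MI n h) :
    wgt n q h β γ ^ 2 * ((Oset n q (fun v => (β.1 v : ℕ) + (γ.1 v : ℕ))).card : ℝ) ≤ 1 := by
  unfold wgt
  split_ifs with hd
  · rw [mul_pow, Real.sq_sqrt (by positivity)]
    have h1 : (Oset n h (fun v => (β.1 v : ℕ))).card ≤ h.factorial :=
      Oset_card_le fun v => by have := hd v; omega
    have h2 : (Oset n h (fun v => (γ.1 v : ℕ))).card ≤ h.factorial :=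
      Oset_card_le fun v => by have := hd v; omega
    have h3 : (Oset n q (fun v => (β.1 v : ℕ) + (γ.1 v : ℕ))).card ≤ q.factorial :=
      Oset_card_le hd
    have h4 : h.factorial * h.factorial ≤ q.factorial := by
      rw [hq]
      exact Nat.le_of_dvd (Nat.factorial_pos _) (Nat.factorial_mul_factorial_dvd_factorial_add h h)
    have h5 : (Oset n h (fun v => (β.1 v : ℕ))).card * (Oset n h (fun v => (γ.1 v : ℕ))).card *
      (Oset n q (fun v => (β.1 v : ℕ) + (γ.1 v : ℕ))).card ≤ q.factorial * q.factorial :=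
      Nat.mul_le_mul ((Nat.mul_le_mul h1 h2).trans h4) h3
    have h6 : (((Oset n h (fun v => (β.1 v : ℕ))).card : ℝ) *
      (Oset n h (fun v => (γ.1 v : ℕ))).card *
      (Oset n q (fun v => (β.1 v : ℕ) + (γ.1 v : ℕ))).card) ≤ q.factorial * q.factorial := by
      exact_mod_cast h5
    have hp : (0:ℝ) < q.factorial := by exact_mod_cast Nat.factorial_pos q
    rw [inv_pow, mul_assoc, inv_mul_le_iff₀ (by positivity)]
    linarith
  · simp

/-- coefficient -/
noncomputable def coef (n q h : ℕ) (u v : MI n h → ℝ) (K : Fin q → Fin n) : ℝ :=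
  ∑ p : MI n h × MI n h, if K ∈ Oset n q (fun w => (p.1.1 w : ℕ) + (p.2.1 w : ℕ)) then
    u p.1 * wgt n q h p.1 p.2 * v p.2 else 0

lemma coef_sq_le (n q h : ℕ) (hq : q = h + h) (u v : MI n h → ℝ)
    (hu : ∑ i, u i ^ 2 ≤ 1) (hv : ∑ i, v i ^ 2 ≤ 1) :
    ∑ K, coef n q h u v K ^ 2 ≤ 2 ^ q := by
  have h1 : ∀ K, coef n q h u v K ^ 2 ≤ 2 ^ q * ∑ p : MI n h × MI n h,
      if K ∈ Oset n q (fun w => (p.1.1 w : ℕ) + (p.2.1 w : ℕ)) then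
        (u p.1 * wgt n q h p.1 p.2 * v p.2) ^ 2 else 0 := by
    intro K
    set F := (Finset.univ : Finset (MI n h × MI n h)).filter fun p =>
      (∀ v, (p.1.1 v : ℕ) + (p.2.1 v : ℕ) ≤ 1) ∧
      K ∈ Oset n q (fun v => (p.1.1 v : ℕ) + (p.2.1 v : ℕ)) with hF
    have e : coef n q h u v K = ∑ p ∈ F, u p.1 * wgt n q h p.1 p.2 * v p.2 := by
      unfold coef
      rw [hF, Finset.sum_filter]
      refine Finset.sum_congr rfl fun p _ => ?_
      by_cases hd : ∀ v, (p.1.1 v : ℕ) + (p.2.1 v : ℕ) ≤ 1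
      · simp [hd]
      · simp [hd, wgt]
    rw [e]
    refine (sq_sum_le_card_mul_sum_sq).trans ?_
    have hc : (F.card : ℝ) ≤ 2 ^ q := by exact_mod_cast pairs_card_le K
    refine mul_le_mul hc ?_ (Finset.sum_nonneg fun _ _ => sq_nonneg _) (by positivity)
    rw [hF, Finset.sum_filter]
    refine Finset.sum_le_sum fun p _ => ?_
    split_ifs with a b b
    · exact le_rfl
    · exact absurd a.2 b
    · positivity
    · exact le_rfl
  calc ∑ K, coef n q h u v K ^ 2 ≤ ∑ K, 2 ^ q * ∑ p : MI n h × MI n h,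
      (if K ∈ Oset n q (fun w => (p.1.1 w : ℕ) + (p.2.1 w : ℕ)) then
        (u p.1 * wgt n q h p.1 p.2 * v p.2) ^ 2 else 0) := Finset.sum_le_sum fun K _ => h1 K
    _ = 2 ^ q * ∑ p : MI n h × MI n h, (u p.1 ^ 2 * v p.2 ^ 2) * (wgt n q h p.1 p.2 ^ 2 *
        ((Oset n q (fun w => (p.1.1 w : ℕ) + (p.2.1 w : ℕ))).card : ℝ)) := by
      rw [← Finset.mul_sum, Finset.sum_comm]
      congr 1
      refine Finset.sum_congr rfl fun p _ => ?_
      rw [← Finset.sum_filter, Finset.sum_const, nsmul_eq_mul]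
      rw [Finset.filter_mem_eq_inter, Finset.univ_inter]
      ring
    _ ≤ 2 ^ q * ∑ p : MI n h × MI n h, (u p.1 ^ 2 * v p.2 ^ 2) * 1 := by
      gcongr with p
      exact wgt_sq_le n q h hq p.1 p.2
    _ = 2 ^ q * ((∑ i, u i ^ 2) * ∑ i, v i ^ 2) := by
      rw [Finset.sum_mul_sum, Fintype.sum_prod_type]; simp
    _ ≤ 2 ^ q * (1 * 1) := by
      gcongr
    _ = _ := by ring

/-- the matrix -/
noncomputable def Mmat (n q h : ℕ) (A : (Fin q → Fin n) → ℝ) (β γ : MI n h) : ℝ :=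
  (if ∀ v, (β.1 v : ℕ) + (γ.1 v : ℕ) ≤ 1
             then ((Nat.factorial q : ℝ))⁻¹ *
               ∑ K ∈ Oset n q (fun v => (β.1 v : ℕ) + (γ.1 v : ℕ)), A K
             else 0) *
            Real.sqrt (((Oset n h (fun v => (β.1 v : ℕ))).card : ℝ) *
              ((Oset n h (fun v => (γ.1 v : ℕ))).card : ℝ))

lemma bilin_eq (n q h : ℕ) (A : (Fin q → Fin n) → ℝ) (u v : MI n h → ℝ) :
    ∑ i, ∑ j, u i * Mmat n q h A i j * v j = ∑ K, coef n q h u v K * A K := by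
  have h1 : ∀ β γ, Mmat n q h A β γ = wgt n q h β γ *
      ∑ K ∈ Oset n q (fun v => (β.1 v : ℕ) + (γ.1 v : ℕ)), A K := by
    intro β γ
    unfold Mmat wgt
    split_ifs <;> ring
  unfold coef
  simp_rw [Finset.sum_mul]
  conv_rhs => rw [Finset.sum_comm, Fintype.sum_prod_type]
  refine Finset.sum_congr rfl fun i _ => Finset.sum_congr rfl fun j _ => ?_
  rw [h1]
  simp_rw [ite_mul, zero_mul]
  rw [← Finset.sum_filter, Finset.filter_mem_eq_inter, Finset.univ_inter, ← Finset.mul_sum]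
  ring

lemma card_MI_ge (n h : ℕ) (hh : 1 ≤ h) : n ≤ Fintype.card (MI n h) := by
  classical
  have : Function.Injective (fun i : Fin n =>
      (⟨Pi.single i (Fin.last h), by
        rw [Finset.sum_eq_single i] <;> simp +contextual⟩ : MI n h)) := by
    intro i j hij
    have := congrFun (congrArg Subtype.val hij) i
    simp only [Pi.single_eq_same, Pi.single_apply] at this
    by_contra hne
    rw [if_neg hne] at this
    have := congrArg Fin.val this
    simp at this
    omega
  simpa using Fintype.card_le_of_injective _ this

lemma card_MI_le (n h : ℕ) (hh : 1 ≤ h) (hn : 2 * h ≤ n) :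
    (Fintype.card (MI n h) : ℝ) ≤ (8 * n / h) ^ h := by
  classical
  have hh' : (1:ℝ) ≤ h := by exact_mod_cast hh
  have hn' : (2:ℝ) * h ≤ n := by exact_mod_cast hn
  have hn0 : (0:ℝ) < n := by linarith
  set x : ℝ := h / n with hx
  have hx0 : 0 < x := by positivity
  have hx1 : x ≤ 1 / 2 := by rw [hx, div_le_iff₀ hn0]; linarith
  have hg : ∑ j : Fin (h + 1), x ^ (j : ℕ) ≤ Real.exp (2 * x) := by
    rw [Fin.sum_univ_eq_sum_range (fun j => x ^ j)]
    have e1 : ∑ j ∈ Finset.range (h + 1), x ^ j ≤ (1 - x)⁻¹ := by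
      rw [← tsum_geometric_of_lt_one hx0.le (by linarith)]
      exact (summable_geometric_of_lt_one hx0.le (by linarith)).sum_le_tsum _
        (fun _ _ => by positivity)
    have e2 : (1 - x)⁻¹ ≤ 1 + 2 * x := by
      rw [inv_le_iff_one_le_mul₀ (by linarith)]
      nlinarith
    have e3 := Real.add_one_le_exp (2 * x)
    linarith
  have h1 : (Fintype.card (MI n h) : ℝ) * x ^ h ≤ ∑ α : Fin n → Fin (h + 1), ∏ i, x ^ (α i : ℕ) := by
    calc (Fintype.card (MI n h) : ℝ) * x ^ h = ∑ α : MI n h, ∏ i, x ^ (α.1 i : ℕ) := by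
          rw [← Finset.card_univ, ← nsmul_eq_mul, ← Finset.sum_const]
          refine Finset.sum_congr rfl fun α _ => ?_
          rw [Finset.prod_pow_eq_pow_sum, α.2]
      _ = ∑ α ∈ Finset.univ.map (Function.Embedding.subtype
            (fun α : Fin n → Fin (h + 1) => ∑ i, ((α i : ℕ)) = h)), ∏ i, x ^ (α i : ℕ) := by
          rw [Finset.sum_map]; rfl
      _ ≤ _ := Finset.sum_le_sum_of_subset_of_nonneg (Finset.subset_univ _)
          fun _ _ _ => Finset.prod_nonneg fun _ _ => by positivity
  have h2 := (Finset.prod_univ_sum (fun _ : Fin n => (Finset.univ : Finset (Fin (h+1))))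
    (fun _ j => x ^ (j : ℕ)))
  rw [Fintype.piFinset_univ] at h2
  rw [← h2] at h1
  have h3 : ∏ _i : Fin n, ∑ j : Fin (h + 1), x ^ (j : ℕ) ≤ (8:ℝ) ^ h := by
    calc _ ≤ ∏ _i : Fin n, Real.exp (2 * x) :=
          Finset.prod_le_prod (fun _ _ => Finset.sum_nonneg fun _ _ => by positivity)
            (fun _ _ => hg)
      _ = Real.exp 2 ^ h := by
          rw [Finset.prod_const, ← Real.exp_nat_mul, ← Real.exp_nat_mul]
          congr 1
          simp [hx]; field_simp
      _ ≤ 8 ^ h := by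
          gcongr
          have := Real.exp_one_lt_d9
          have h0 := Real.exp_pos 1
          rw [show (2:ℝ) = 1 + 1 by norm_num, Real.exp_add]
          nlinarith
  have h4 : ((8:ℝ) * n / h) ^ h = 8 ^ h / x ^ h := by
    rw [← div_pow, hx]; congr 1; field_simp
  rw [h4, le_div_iff₀ (by positivity)]
  exact h1.trans h3

lemma exp_bound (N : ℕ) (hN : 1 ≤ N) :
    2 * (25:ℝ) ^ N * Real.exp (-(8 * N)) ≤ Real.exp (-N) := by
  have h1 : (2:ℝ) * 25 ^ N ≤ 50 ^ N := by
    have : (2:ℝ) ≤ 2 ^ N := by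
      calc (2:ℝ) = 2 ^ 1 := by norm_num
        _ ≤ 2 ^ N := pow_le_pow_right₀ (by norm_num) hN
    calc (2:ℝ) * 25 ^ N ≤ 2 ^ N * 25 ^ N := by gcongr
      _ = 50 ^ N := by rw [← mul_pow]; norm_num
  have h2 : (50:ℝ) ≤ Real.exp 7 := by
    have h0 := Real.add_one_le_exp (1:ℝ)
    calc (50:ℝ) ≤ 2 ^ 7 := by norm_num
      _ ≤ Real.exp 1 ^ 7 := by gcongr; linarith
      _ = Real.exp 7 := by rw [← Real.exp_nat_mul]; norm_num
  calc 2 * (25:ℝ) ^ N * Real.exp (-(8 * N)) ≤ Real.exp 7 ^ N * Real.exp (-(8 * N)) := by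
        gcongr
        exact h1.trans (by gcongr)
    _ = Real.exp (-N) := by
        rw [← Real.exp_nat_mul, ← Real.exp_add]; congr 1; ring

lemma final_bound (n q h N : ℕ) (hq : q = h + h) (hh : 1 ≤ h) (hn : 2 * h ≤ n)
    (hN : (N : ℝ) ≤ (8 * n / h) ^ h) :
    4 * (4 * Real.sqrt (2 ^ q * N)) ≤
      16 ^ q * (n : ℝ) ^ ((q : ℝ) / 4) / (q : ℝ) ^ ((q : ℝ) / 4) := by
  have hh' : (1:ℝ) ≤ h := by exact_mod_cast hh
  have hn' : (2:ℝ) * h ≤ n := by exact_mod_cast hn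
  have hq' : (q:ℝ) = h + h := by exact_mod_cast hq
  have hn0 : (0:ℝ) < n := by linarith
  have hq0 : (0:ℝ) < q := by linarith
  rw [mul_div_assoc, ← Real.div_rpow hn0.le hq0.le]
  set R : ℝ := ((n:ℝ) / q) ^ ((q:ℝ) / 4) with hR
  have hR0 : 0 ≤ R := by positivity
  have hR2 : R ^ 2 = ((n:ℝ) / q) ^ h := by
    rw [hR, ← Real.rpow_natCast, ← Real.rpow_mul (by positivity), ← Real.rpow_natCast]
    congr 1
    push_cast
    rw [hq']; ring
  have e1 : ((8:ℝ) * n / h) ^ h = 4 ^ q * R ^ 2 := by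
    rw [hR2, hq, ← two_mul, pow_mul, ← mul_pow]
    congr 1
    push_cast
    field_simp
    norm_num
  rw [e1] at hN
  have e2 : Real.sqrt (2 ^ q * N) ≤ 4 ^ q * R := by
    apply Real.sqrt_le_iff.2 ⟨by positivity, ?_⟩
    calc (2:ℝ) ^ q * N ≤ 4 ^ q * (4 ^ q * R ^ 2) := by gcongr; norm_num
      _ = _ := by ring
  have e3 : (16:ℝ) ≤ 4 ^ q := by
    calc (16:ℝ) = 4 ^ 2 := by norm_num
      _ ≤ 4 ^ q := pow_le_pow_right₀ (by norm_num) (by omega)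
  calc 4 * (4 * Real.sqrt (2 ^ q * N)) ≤ 16 * (4 ^ q * R) := by linarith
    _ ≤ 4 ^ q * (4 ^ q * R) := by gcongr
    _ = 16 ^ q * R := by
      rw [← mul_assoc, ← mul_pow]; norm_num

lemma main_prob (n q h : ℕ) (hq : q = h + h) (hh : 1 ≤ h) (hn : 2 * h ≤ n) :
    1 - (n : ℝ) ^ (-(1:ℝ)) ≤ tprob n q (fun A => opNorm (Mmat n q h A) ≤
      16 ^ q * (n : ℝ) ^ ((q : ℝ) / 4) / (q : ℝ) ^ ((q : ℝ) / 4)) := by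
  classical
  set N := Fintype.card (MI n h) with hNdef
  have hNn : n ≤ N := card_MI_ge n h hh
  have hN1 : 1 ≤ N := by omega
  have hfin := final_bound n q h N hq hh hn (card_MI_le n h hh hn)
  set B : ℝ := 16 ^ q * (n : ℝ) ^ ((q : ℝ) / 4) / (q : ℝ) ^ ((q : ℝ) / 4) with hB
  set t : ℝ := 4 * Real.sqrt (2 ^ q * N) with ht
  have ht0 : 0 ≤ t := by positivity
  have ht2 : t ^ 2 / (2 * 2 ^ q) = 8 * N := by
    rw [ht, mul_pow, Real.sq_sqrt (by positivity)]; field_simp; norm_num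
  obtain ⟨s, hsc, hs1, hsn⟩ := exists_net (MI n h)
  let κ := Fin q → Fin n
  let E : EuclideanSpace ℝ (MI n h) × EuclideanSpace ℝ (MI n h) → Finset (κ → Bool) := fun p =>
    Finset.univ.filter fun A : κ → Bool =>
      t < |∑ K, coef n q h p.1 p.2 K * (if A K then (1:ℝ) else -1)|
  let Bad : Finset (κ → Bool) := (s ×ˢ s).biUnion E
  have hnorm : ∀ u : EuclideanSpace ℝ (MI n h), ‖u‖ = 1 → ∑ i, u i ^ 2 ≤ 1 := by
    intro u hu
    rw [← EuclideanSpace.real_norm_sq_eq, hu]; norm_num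
  have hE : ∀ p ∈ s ×ˢ s, ((E p).card : ℝ) ≤
      2 * (2 ^ Fintype.card κ * Real.exp (-(8 * N))) := by
    intro p hp
    obtain ⟨hp1, hp2⟩ := Finset.mem_product.1 hp
    rw [← ht2]
    exact tail_two _ _ t (by positivity) ht0
      (coef_sq_le n q h hq _ _ (hnorm _ (hs1 _ hp1)) (hnorm _ (hs1 _ hp2)))
  have hBad : (Bad.card : ℝ) ≤ 2 ^ Fintype.card κ * Real.exp (-N) := by
    have h1 : (Bad.card : ℝ) ≤ ∑ p ∈ s ×ˢ s, ((E p).card : ℝ) := by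
      exact_mod_cast Finset.card_biUnion_le
    have h2 := h1.trans (Finset.sum_le_sum hE)
    rw [Finset.sum_const, nsmul_eq_mul, Finset.card_product] at h2
    have h3 : ((s.card * s.card : ℕ) : ℝ) ≤ 25 ^ N := by
      have : s.card * s.card ≤ 25 ^ N := by
        calc s.card * s.card ≤ 5 ^ N * 5 ^ N := Nat.mul_le_mul hsc hsc
          _ = 25 ^ N := by rw [← mul_pow]; norm_num
      exact_mod_cast this
    calc (Bad.card : ℝ) ≤ _ := h2
      _ ≤ 25 ^ N * (2 * (2 ^ Fintype.card κ * Real.exp (-(8 * N)))) := by gcongr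
      _ = 2 ^ Fintype.card κ * (2 * 25 ^ N * Real.exp (-(8 * N))) := by ring
      _ ≤ _ := by gcongr; exact exp_bound N hN1
  have hgood : ∀ A : κ → Bool, A ∉ Bad → opNorm (Mmat n q h (signT A)) ≤ B := by
    intro A hA
    refine Real.sSup_le ?_ (le_trans (by positivity) hfin)
    rintro r ⟨u, v, hu, hv, rfl⟩
    refine le_trans (bilin_le_of_net (s : Set _) (fun u hu => by simpa using hsn u hu) t ht0
      (Mmat n q h (signT A)) ?_ u v hu hv) hfin
    intro u hu v hv
    rw [bilin_eq]
    by_contra hlt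
    exact hA (Finset.mem_biUnion.2 ⟨(u, v), Finset.mem_product.2 ⟨hu, hv⟩,
      Finset.mem_filter.2 ⟨Finset.mem_univ _, not_le.1 hlt⟩⟩)
  unfold tprob
  have hcard : (Fintype.card (κ → Bool) : ℝ) = 2 ^ Fintype.card κ := by simp
  rw [Nat.card_eq_fintype_card, Fintype.card_subtype, hcard, le_div_iff₀ (by positivity)]
  have hsub : Badᶜ ⊆ Finset.univ.filter fun A : κ → Bool => opNorm (Mmat n q h (signT A)) ≤ B := by
    intro A hA
    exact Finset.mem_filter.2 ⟨Finset.mem_univ _, hgood A (Finset.mem_compl.1 hA)⟩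
  have hle : ((Badᶜ.card : ℕ) : ℝ) ≤ _ := Nat.cast_le.2 (Finset.card_le_card hsub)
  have hsum : (Bad.card : ℝ) + (Badᶜ.card : ℝ) = 2 ^ Fintype.card κ := by
    rw [← hcard]; exact_mod_cast Finset.card_add_card_compl Bad
  have hexp : Real.exp (-N) ≤ (n:ℝ) ^ (-(1:ℝ)) := by
    have hn0 : (0:ℝ) < n := by
      have : 0 < n := by omega
      exact_mod_cast this
    have hnN : (n:ℝ) ≤ N := by exact_mod_cast hNn
    rw [Real.rpow_neg_one, Real.exp_neg]
    apply inv_anti₀ hn0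
    have := Real.add_one_le_exp (N:ℝ)
    linarith
  have h5 : (2:ℝ) ^ Fintype.card κ * Real.exp (-N) ≤
      2 ^ Fintype.card κ * (n:ℝ) ^ (-(1:ℝ)) := by gcongr
  refine le_trans ?_ hle
  linarith

theorem stmt_11 : ∃ C c : ℝ, 0 < C ∧ 0 < c ∧
    ∀ n q : ℕ, 2 ≤ q → q % 2 = 0 → q ≤ n →
      1 - (n : ℝ) ^ (-c) ≤
        tprob n q (fun A =>
          opNorm (fun β γ : {α : Fin n → Fin (q / 2 + 1) // ∑ i, ((α i : ℕ)) = q / 2} =>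
            (if ∀ v, (β.1 v : ℕ) + (γ.1 v : ℕ) ≤ 1
             then ((Nat.factorial q : ℝ))⁻¹ *
               ∑ K ∈ Oset n q (fun v => (β.1 v : ℕ) + (γ.1 v : ℕ)), A K
             else 0) *
            Real.sqrt (((Oset n (q / 2) (fun v => (β.1 v : ℕ))).card : ℝ) *
              ((Oset n (q / 2) (fun v => (γ.1 v : ℕ))).card : ℝ))) ≤
          C ^ q * (n : ℝ) ^ ((q : ℝ) / 4) / (q : ℝ) ^ ((q : ℝ) / 4)) := by
  refine ⟨16, 1, by norm_num, by norm_num, ?_⟩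
  intro n q h2 hq hn
  exact main_prob n q (q / 2) (by omega) (by omega) (by omega)
end

section
/- Let k ≥ 1 and let 𝖠 ∈ ℝ^{[n]^k×[n]^k} be any SoS-symmetric matrix. Then ‖𝖠‖₂ ≤ ‖Â_Q‖₂, where Â_Q is the quotient matrix of 𝖠. -/
open scoped BigOperators

lemma opNorm_nonneg' {ι κ : Type*} [Fintype ι] [Fintype κ] (M : ι → κ → ℝ) : 0 ≤ opNorm M := by
  apply Real.sSup_nonneg
  rintro r ⟨u, v, _, _, rfl⟩
  exact abs_nonneg _

lemma opNorm_bdd {ι κ : Type*} [Fintype ι] [Fintype κ] (M : ι → κ → ℝ) :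
    BddAbove {r : ℝ | ∃ (u : EuclideanSpace ℝ ι) (v : EuclideanSpace ℝ κ),
    ‖u‖ = 1 ∧ ‖v‖ = 1 ∧ r = |∑ i, ∑ j, u i * M i j * v j|} := by
  refine ⟨∑ i, ∑ j, |M i j|, ?_⟩
  rintro r ⟨u, v, hu, hv, rfl⟩
  refine (Finset.abs_sum_le_sum_abs _ _).trans (Finset.sum_le_sum fun i _ => ?_)
  refine (Finset.abs_sum_le_sum_abs _ _).trans (Finset.sum_le_sum fun j _ => ?_)
  have h1 : |u i| ≤ 1 := by
    have := PiLp.norm_apply_le u i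
    rwa [hu, Real.norm_eq_abs] at this
  have h2 : |v j| ≤ 1 := by
    have := PiLp.norm_apply_le v j
    rwa [hv, Real.norm_eq_abs] at this
  rw [abs_mul, abs_mul]
  calc |u i| * |M i j| * |v j| ≤ 1 * |M i j| * 1 := by gcongr
    _ = |M i j| := by ring

lemma abs_le_opNorm {ι κ : Type*} [Fintype ι] [Fintype κ] (M : ι → κ → ℝ)
    (a : EuclideanSpace ℝ ι) (b : EuclideanSpace ℝ κ) (ha : ‖a‖ ≤ 1) (hb : ‖b‖ ≤ 1) :
    |∑ i, ∑ j, a i * M i j * b j| ≤ opNorm M := by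
  by_cases ha0 : a = 0
  · simp [ha0, opNorm_nonneg']
  by_cases hb0 : b = 0
  · simp [hb0, opNorm_nonneg']
  have hna : 0 < ‖a‖ := norm_pos_iff.2 ha0
  have hnb : 0 < ‖b‖ := norm_pos_iff.2 hb0
  have key : |∑ i, ∑ j, (‖a‖⁻¹ • a) i * M i j * (‖b‖⁻¹ • b) j| ≤ opNorm M := by
    apply le_csSup (opNorm_bdd M)
    refine ⟨‖a‖⁻¹ • a, ‖b‖⁻¹ • b, ?_, ?_, rfl⟩
    · rw [norm_smul, norm_inv, norm_norm, inv_mul_cancel₀ hna.ne']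
    · rw [norm_smul, norm_inv, norm_norm, inv_mul_cancel₀ hnb.ne']
  have e : ∑ i, ∑ j, a i * M i j * b j =
      (‖a‖ * ‖b‖) * ∑ i, ∑ j, (‖a‖⁻¹ • a) i * M i j * (‖b‖⁻¹ • b) j := by
    simp only [Finset.mul_sum, PiLp.smul_apply, smul_eq_mul]
    refine Finset.sum_congr rfl fun i _ => Finset.sum_congr rfl fun j _ => ?_
    field_simp
  rw [e, abs_mul, abs_of_pos (mul_pos hna hnb)]
  calc _ ≤ 1 * |∑ i, ∑ j, (‖a‖⁻¹ • a) i * M i j * (‖b‖⁻¹ • b) j| := by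
        gcongr
        exact mul_le_one₀ ha hnb.le hb
    _ ≤ _ := by rwa [one_mul]

/-- Push-forward of a vector to the quotient. -/
noncomputable def pushV {ι κ : Type*} [Fintype ι] [Fintype κ] [DecidableEq κ] (f : ι → κ)
    (u : EuclideanSpace ℝ ι) : EuclideanSpace ℝ κ :=
  WithLp.toLp 2 fun b => ∑ i with f i = b,
    u i / Real.sqrt ((Finset.univ.filter fun i => f i = b).card : ℝ)

lemma pushV_norm {ι κ : Type*} [Fintype ι] [Fintype κ] [DecidableEq κ] (f : ι → κ)
    (u : EuclideanSpace ℝ ι) (hu : ‖u‖ = 1) : ‖pushV f u‖ ≤ 1 := by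
  rw [EuclideanSpace.norm_eq] at hu ⊢
  rw [Real.sqrt_eq_one] at hu
  rw [Real.sqrt_le_iff]
  refine ⟨zero_le_one, ?_⟩
  rw [one_pow, ← hu, ← Finset.sum_fiberwise Finset.univ f]
  refine Finset.sum_le_sum fun b _ => ?_
  simp only [Real.norm_eq_abs, sq_abs, pushV]
  rw [← Finset.sum_div, div_pow, Real.sq_sqrt (Nat.cast_nonneg _)]
  refine div_le_of_le_mul₀ (Nat.cast_nonneg _) (Finset.sum_nonneg fun _ _ => sq_nonneg _) ?_
  rw [mul_comm]
  exact sq_sum_le_card_mul_sum_sq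

lemma opNorm_quot {ι κ : Type*} [Fintype ι] [Fintype κ] [DecidableEq κ] (f : ι → κ)
    (M : ι → ι → ℝ) (Q : κ → κ → ℝ)
    (h : ∀ i j, Q (f i) (f j) = M i j *
      Real.sqrt (((Finset.univ.filter fun l => f l = f i).card : ℝ) *
        ((Finset.univ.filter fun l => f l = f j).card : ℝ))) :
    opNorm M ≤ opNorm Q := by
  refine Real.sSup_le ?_ (opNorm_nonneg' Q)
  rintro r ⟨u, v, hu, hv, rfl⟩
  refine le_of_eq_of_le ?_
    (abs_le_opNorm Q (pushV f u) (pushV f v) (pushV_norm f u hu) (pushV_norm f v hv))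
  congr 1
  rw [← Finset.sum_fiberwise Finset.univ f]
  refine Finset.sum_congr rfl fun b _ => ?_
  rw [Finset.sum_comm, ← Finset.sum_fiberwise Finset.univ f]
  refine Finset.sum_congr rfl fun c _ => ?_
  rw [Finset.sum_comm]
  simp only [pushV]
  rw [Finset.sum_mul, Finset.sum_mul]
  refine Finset.sum_congr rfl fun i hi => ?_
  rw [Finset.mul_sum]
  refine Finset.sum_congr rfl fun j hj => ?_
  obtain rfl := (Finset.mem_filter.1 hi).2
  obtain rfl := (Finset.mem_filter.1 hj).2
  rw [h, Real.sqrt_mul (Nat.cast_nonneg _)]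
  have p : ∀ i, 0 < Real.sqrt ((Finset.univ.filter fun l => f l = f i).card : ℝ) := fun i => by
    apply Real.sqrt_pos.2
    exact_mod_cast Finset.card_pos.2 ⟨i, by simp⟩
  have p1 := (p i).ne'
  have p2 := (p j).ne'
  field_simp

lemma cnt_sum {n k : ℕ} (I : Fin k → Fin n) : ∑ v, cnt I v = k := by
  have := Finset.card_eq_sum_card_fiberwise (f := I) (s := Finset.univ) (t := Finset.univ)
    (fun _ _ => Finset.mem_coe.2 (Finset.mem_univ _))
  simpa [cnt] using this.symm

lemma cnt_lt {n k : ℕ} (I : Fin k → Fin n) (v : Fin n) : cnt I v < k + 1 := by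
  have := Finset.card_le_univ (Finset.univ.filter fun l => I l = v)
  rw [Fintype.card_fin] at this
  exact Nat.lt_succ_of_le this

/-- The multi-index of a tuple. -/
def tupIdx {n k : ℕ} (I : Fin k → Fin n) : {α : Fin n → Fin (k + 1) // ∑ i, ((α i : ℕ)) = k} :=
  ⟨fun v => ⟨cnt I v, cnt_lt I v⟩, cnt_sum I⟩

lemma Oset_tupIdx {n k : ℕ} (I : Fin k → Fin n) :
    (Oset n k fun v => ((tupIdx I).1 v : ℕ)) =
      Finset.univ.filter fun l => tupIdx l = tupIdx I := by
  ext K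
  rw [Oset, Finset.mem_filter, Finset.mem_filter]
  simp [tupIdx, funext_iff]

theorem stmt_12 (n k : ℕ) (hk : 1 ≤ k)
    (A : (Fin k → Fin n) → (Fin k → Fin n) → ℝ)
    (hsos : ∀ I J K L : Fin k → Fin n,
      (∀ v, cnt I v + cnt J v = cnt K v + cnt L v) → A I J = A K L)
    (Q : {α : Fin n → Fin (k + 1) // ∑ i, ((α i : ℕ)) = k} →
         {α : Fin n → Fin (k + 1) // ∑ i, ((α i : ℕ)) = k} → ℝ)
    (hQ : ∀ β γ, ∀ I J : Fin k → Fin n,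
      (∀ v, cnt I v = (β.1 v : ℕ)) → (∀ v, cnt J v = (γ.1 v : ℕ)) →
      Q β γ = A I J *
        Real.sqrt (((Oset n k fun v => (β.1 v : ℕ)).card : ℝ) *
          ((Oset n k fun v => (γ.1 v : ℕ)).card : ℝ))) :
    opNorm A ≤ opNorm Q := by
  refine opNorm_quot tupIdx A Q fun I J => ?_
  rw [hQ (tupIdx I) (tupIdx J) I J (fun _ => rfl) (fun _ => rfl), Oset_tupIdx, Oset_tupIdx]
end

section
/- There exist absolute constants c₁ ∈ (0,1) and c₂ > 0 such that for every even q with 2 ≤ q ≤ n, the following holds with probability at least 1 − n^{−c₂} over a random q-tensor A with i.i.d. entries uniform on {−1,+1}: there exists a matrix 𝖬 ∈ ℝ^{[n]^{q/2}×[n]^{q/2}} that is symmetric positive semidefinite, SoS-symmetric, has trace Tr(𝖬) = 1, and satisfies Σ_{I,J∈[n]^{q/2}} A_{I⊕J}·𝖬[I,J] ≥ c₁^q · n^{q/4} / q^{q/4}. (Such an 𝖬 is a feasible homogeneous degree-q moment matrix, so this certifies a lower bound on the value of the degree-q sum-of-squares relaxation of max_{‖x‖₂=1} ⟨A, x^{⊗q}⟩.)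 -/
open scoped BigOperators

def sg (b : Bool) : ℝ := if b then 1 else -1

lemma sg_sq (b : Bool) : sg b * sg b = 1 := by cases b <;> simp [sg]

lemma sg_not (b : Bool) : sg (!b) = - sg b := by cases b <;> simp [sg]

/-- Hoeffding's inequality for Rademacher sums, in counting form. -/
lemma hoeffding_count {κ : Type*} [Fintype κ] [DecidableEq κ] (a : κ → ℝ) (s V : ℝ)
    (hV : ∑ k, a k ^ 2 ≤ V) (hV0 : 0 < V) (hs : 0 ≤ s) :
    ((Finset.univ.filter fun A : κ → Bool => s ≤ ∑ k, a k * sg (A k)).card : ℝ) ≤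
      Real.exp (-(s ^ 2 / (2 * V))) * (Fintype.card (κ → Bool) : ℝ) := by
  set θ := s / V with hθ
  have hθ0 : 0 ≤ θ := by positivity
  have h1 : ∑ A : κ → Bool, Real.exp (θ * ∑ k, a k * sg (A k)) =
      ∏ k, (Real.exp (θ * a k) + Real.exp (-(θ * a k))) := by
    have := Finset.prod_univ_sum (fun _ : κ => (Finset.univ : Finset Bool))
      (fun k b => Real.exp (θ * (a k * sg b)))
    rw [Fintype.piFinset_univ] at this
    rw [Finset.sum_congr rfl (fun A _ => by
      rw [Finset.mul_sum, Real.exp_sum]), ← this]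
    apply Finset.prod_congr rfl
    intro k _
    simp [sg]
  have h2 : ∏ k, (Real.exp (θ * a k) + Real.exp (-(θ * a k))) ≤
      ∏ k, (2 * Real.exp ((θ * a k) ^ 2 / 2)) := by
    apply Finset.prod_le_prod
    · intro k _; positivity
    · intro k _
      have := Real.cosh_le_exp_half_sq (θ * a k)
      rw [Real.cosh_eq] at this
      linarith
  have h3 : ∏ k, (2 * Real.exp ((θ * a k) ^ 2 / 2)) ≤
      (Fintype.card (κ → Bool) : ℝ) * Real.exp (θ ^ 2 * V / 2) := by
    rw [Finset.prod_mul_distrib, ← Real.exp_sum]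
    simp only [Finset.prod_const, Fintype.card_fun, Fintype.card_bool, Finset.card_univ,
      Nat.cast_pow, Nat.cast_ofNat]
    gcongr
    rw [← Finset.sum_div]
    have : ∑ k, (θ * a k) ^ 2 = θ ^ 2 * ∑ k, a k ^ 2 := by
      rw [Finset.mul_sum]; exact Finset.sum_congr rfl (fun k _ => by ring)
    rw [this]
    gcongr
  have h4 : ((Finset.univ.filter fun A : κ → Bool => s ≤ ∑ k, a k * sg (A k)).card : ℝ) *
      Real.exp (θ * s) ≤ ∑ A : κ → Bool, Real.exp (θ * ∑ k, a k * sg (A k)) := by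
    rw [← nsmul_eq_mul, ← Finset.sum_const]
    refine le_trans (Finset.sum_le_sum (fun A hA => ?_))
      (Finset.sum_le_sum_of_subset_of_nonneg (Finset.subset_univ _)
        (fun A _ _ => (Real.exp_pos _).le))
    rw [Finset.mem_filter] at hA
    exact Real.exp_le_exp.mpr (mul_le_mul_of_nonneg_left hA.2 hθ0)
  have h5 := (h4.trans h1.le).trans (h2.trans h3)
  have e1 : θ * s = s ^ 2 / V := by rw [hθ]; ring
  have e2 : θ ^ 2 * V / 2 = s ^ 2 / V - s ^ 2 / (2 * V) := by rw [hθ]; field_simp; norm_num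
  rw [e1, e2, sub_eq_add_neg, Real.exp_add] at h5
  have hp := Real.exp_pos (s ^ 2 / V)
  refine le_of_mul_le_mul_right ?_ hp
  linarith

/-- Flipping one coordinate. -/
lemma sum_flip_zero {κ : Type*} [Fintype κ] [DecidableEq κ] (k : κ) (g : (κ → Bool) → ℝ)
    (hg : ∀ A, g (Function.update A k (!(A k))) = - g A) : ∑ A, g A = 0 := by
  let e : (κ → Bool) ≃ (κ → Bool) :=
    { toFun := fun A => Function.update A k (!(A k))
      invFun := fun A => Function.update A k (!(A k))
      left_inv := fun A => by simp
      right_inv := fun A => by simp }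
  have h := Equiv.sum_comp e g
  have h2 : ∑ A, g (e A) = - ∑ A, g A := by
    rw [← Finset.sum_neg_distrib]
    exact Finset.sum_congr rfl (fun A _ => hg A)
  linarith

lemma fourth_moment {κ : Type*} [Fintype κ] [DecidableEq κ] (i j k l : κ) (hij : i ≠ j)
    (hkl : k ≠ l) :
    ∑ A : κ → Bool, (sg (A i) * sg (A j)) * (sg (A k) * sg (A l)) ≤
      ((if (k, l) = (i, j) then 1 else 0) + (if (k, l) = (j, i) then 1 else 0)) *
        (Fintype.card (κ → Bool) : ℝ) := by
  have hc : (0 : ℝ) ≤ (Fintype.card (κ → Bool) : ℝ) := by positivity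
  by_cases h1 : (k, l) = (i, j)
  · have h2 : (k, l) ≠ (j, i) := by
      intro h; simp only [Prod.mk.injEq] at h h1; exact hij (h1.1.symm.trans h.1)
    rw [if_pos h1, if_neg h2]
    simp only [Prod.mk.injEq] at h1
    rw [h1.1, h1.2, Finset.sum_congr rfl (fun A _ => by
      rw [show (sg (A i) * sg (A j)) * (sg (A i) * sg (A j)) =
        (sg (A i) * sg (A i)) * (sg (A j) * sg (A j)) by ring, sg_sq, sg_sq])]
    simp
  by_cases h2 : (k, l) = (j, i)
  · rw [if_neg h1, if_pos h2]
    simp only [Prod.mk.injEq] at h2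
    rw [h2.1, h2.2, Finset.sum_congr rfl (fun A _ => by
      rw [show (sg (A i) * sg (A j)) * (sg (A j) * sg (A i)) =
        (sg (A i) * sg (A i)) * (sg (A j) * sg (A j)) by ring, sg_sq, sg_sq])]
    simp
  rw [if_neg h1, if_neg h2]
  simp only [Prod.mk.injEq, not_and] at h1 h2
  have : ∑ A : κ → Bool, (sg (A i) * sg (A j)) * (sg (A k) * sg (A l)) = 0 := by
    by_cases hi : i = k ∨ i = l
    · have hj : j ≠ k ∧ j ≠ l := by
        constructor
        · rintro rfl
          rcases hi with h | h
          · exact hij h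
          · exact h2 rfl h.symm
        · rintro rfl
          rcases hi with h | h
          · exact h1 h.symm rfl
          · exact hij h
      apply sum_flip_zero j
      intro A
      simp [Function.update_of_ne hij, Function.update_of_ne hj.1.symm,
        Function.update_of_ne hj.2.symm, sg_not]
    · push Not at hi
      apply sum_flip_zero i
      intro A
      simp [Function.update_of_ne hij.symm, Function.update_of_ne hi.1.symm,
        Function.update_of_ne hi.2.symm, sg_not]
  rw [this]; simp

/-- Chebyshev for an off-diagonal quadratic chaos. -/
lemma chaos_count {κ : Type*} [Fintype κ] [DecidableEq κ] (R : Finset (κ × κ))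
    (hR : ∀ p ∈ R, p.1 ≠ p.2) (s : ℝ) (hs : 0 < s) :
    ((Finset.univ.filter fun A : κ → Bool =>
      ∑ p ∈ R, sg (A p.1) * sg (A p.2) ≤ -s).card : ℝ) ≤
      2 * R.card / s ^ 2 * (Fintype.card (κ → Bool) : ℝ) := by
  have h1 : ∑ A : κ → Bool, (∑ p ∈ R, sg (A p.1) * sg (A p.2)) ^ 2 ≤
      2 * R.card * (Fintype.card (κ → Bool) : ℝ) := by
    have : ∀ A : κ → Bool, (∑ p ∈ R, sg (A p.1) * sg (A p.2)) ^ 2 =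
        ∑ p ∈ R, ∑ p' ∈ R, (sg (A p.1) * sg (A p.2)) * (sg (A p'.1) * sg (A p'.2)) := by
      intro A; rw [sq, Finset.sum_mul_sum]
    simp_rw [this]
    rw [Finset.sum_comm]
    have hb : ∀ p ∈ R, ∑ A : κ → Bool, ∑ p' ∈ R,
        (sg (A p.1) * sg (A p.2)) * (sg (A p'.1) * sg (A p'.2)) ≤
        2 * (Fintype.card (κ → Bool) : ℝ) := by
      intro p hp
      rw [Finset.sum_comm]
      refine (Finset.sum_le_sum (fun p' hp' =>
        fourth_moment p.1 p.2 p'.1 p'.2 (hR p hp) (hR p' hp'))).trans ?_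
      rw [← Finset.sum_mul]
      gcongr
      rw [Finset.sum_add_distrib]
      have : ∀ z : κ × κ, ∑ p' ∈ R, (if (p'.1, p'.2) = z then (1:ℝ) else 0) ≤ 1 := by
        intro z
        simp only [Prod.mk.eta]
        rw [Finset.sum_ite_eq']
        split_ifs <;> norm_num
      have a1 := this (p.1, p.2)
      have a2 := this (p.2, p.1)
      linarith
    refine (Finset.sum_le_sum hb).trans ?_
    rw [Finset.sum_const, nsmul_eq_mul]
    linarith
  have h2 : ((Finset.univ.filter fun A : κ → Bool =>
      ∑ p ∈ R, sg (A p.1) * sg (A p.2) ≤ -s).card : ℝ) * s ^ 2 ≤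
      ∑ A : κ → Bool, (∑ p ∈ R, sg (A p.1) * sg (A p.2)) ^ 2 := by
    rw [← nsmul_eq_mul, ← Finset.sum_const]
    refine le_trans (Finset.sum_le_sum (fun A hA => ?_))
      (Finset.sum_le_sum_of_subset_of_nonneg (Finset.subset_univ _)
        (fun A _ _ => sq_nonneg _))
    rw [Finset.mem_filter] at hA
    nlinarith [hA.2]
  rw [div_mul_eq_mul_div, le_div_iff₀ (by positivity)]
  exact h2.trans h1

/-- Rounding to integer points. -/
lemma round_int {ι : Type*} [Fintype ι] (a z : ι → ℝ) (hz : ∑ i, z i ^ 2 ≤ Fintype.card ι) :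
    ∃ k : ι → ℤ, (∑ i, (k i : ℝ) ^ 2 ≤ 4 * Fintype.card ι) ∧
      ∑ i, a i * z i ≤ ∑ i, a i * k i := by
  refine ⟨fun i => if 0 ≤ a i then ⌈z i⌉ else ⌊z i⌋, ?_, ?_⟩
  · have : ∀ i, (((if 0 ≤ a i then ⌈z i⌉ else ⌊z i⌋ : ℤ) : ℝ)) ^ 2 ≤ 2 * z i ^ 2 + 2 := by
      intro i
      have h1 := Int.le_ceil (z i)
      have h2 := Int.ceil_lt_add_one (z i)
      have h3 := Int.floor_le (z i)
      have h4 := Int.lt_floor_add_one (z i)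
      split_ifs
      · nlinarith [sq_nonneg (((⌈z i⌉ : ℤ) : ℝ) - 2 * z i)]
      · nlinarith [sq_nonneg (((⌊z i⌋ : ℤ) : ℝ) - 2 * z i)]
    refine (Finset.sum_le_sum (fun i _ => this i)).trans ?_
    rw [Finset.sum_add_distrib, ← Finset.mul_sum]
    simp
    linarith
  · apply Finset.sum_le_sum
    intro i _
    dsimp only
    split_ifs with h
    · exact mul_le_mul_of_nonneg_left (Int.le_ceil _) h
    · push Not at h
      exact mul_le_mul_of_nonpos_left (Int.floor_le _) h.le

/-- The net. -/
noncomputable def intNet (ι : Type*) [Fintype ι] [DecidableEq ι] : Finset (ι → ℤ) :=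
  (Fintype.piFinset fun _ : ι =>
    Finset.Icc (-(4 * Fintype.card ι : ℤ)) (4 * Fintype.card ι)).filter
      fun k => ∑ i, (k i) ^ 2 ≤ 4 * (Fintype.card ι : ℤ)

lemma mem_intNet {ι : Type*} [Fintype ι] [DecidableEq ι] (k : ι → ℤ) :
    k ∈ intNet ι ↔ ∑ i, (k i : ℝ) ^ 2 ≤ 4 * Fintype.card ι := by
  have e : (∑ i, (k i : ℝ) ^ 2 ≤ 4 * Fintype.card ι) ↔
      ∑ i, (k i) ^ 2 ≤ 4 * (Fintype.card ι : ℤ) := by exact_mod_cast Iff.rfl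
  rw [e, intNet, Finset.mem_filter, and_iff_right_iff_imp]
  intro h
  rw [Fintype.mem_piFinset]
  intro i
  have h1 : (k i) ^ 2 ≤ ∑ i, (k i) ^ 2 :=
    Finset.single_le_sum (f := fun i => (k i) ^ 2) (fun _ _ => sq_nonneg _) (Finset.mem_univ i)
  rw [Finset.mem_Icc, ← abs_le]
  have := Int.natAbs_le_self_sq (k i)
  rw [Int.natCast_natAbs] at this
  linarith

lemma sum_half_pow (m : ℕ) :
    ∑ k ∈ Finset.Icc (-(m : ℤ)) m, ((1 : ℝ) / 2) ^ (k.natAbs) ≤ 3 - 2 * (1/2) ^ m := by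
  induction m with
  | zero => simp; norm_num
  | succ m ih =>
    have : Finset.Icc (-((m + 1 : ℕ) : ℤ)) ((m + 1 : ℕ) : ℤ) =
        insert (-((m + 1 : ℕ) : ℤ)) (insert ((m + 1 : ℕ) : ℤ) (Finset.Icc (-(m : ℤ)) m)) := by
      ext x; simp only [Finset.mem_Icc, Finset.mem_insert]; push_cast; omega
    rw [this, Finset.sum_insert, Finset.sum_insert]
    · rw [Int.natAbs_neg, Int.natAbs_natCast, pow_succ]
      linarith
    · simp
    · simp only [Finset.mem_Icc, Finset.mem_insert]; push_cast; omega

lemma card_intNet (ι : Type*) [Fintype ι] [DecidableEq ι] :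
    ((intNet ι).card : ℝ) ≤ 48 ^ (Fintype.card ι) := by
  set N := Fintype.card ι with hN
  have h1 : ((intNet ι).card : ℝ) ≤ ∑ k ∈ Fintype.piFinset fun _ : ι =>
    Finset.Icc (-((4 * N : ℕ) : ℤ)) ((4 * N : ℕ) : ℤ),
      2 ^ (4 * N) * ∏ i, ((1 : ℝ) / 2) ^ ((k i).natAbs) := by
    rw [Finset.card_eq_sum_ones]
    push_cast
    rw [intNet, ← hN]
    refine le_trans (Finset.sum_le_sum (fun k hk => ?_))
      (Finset.sum_le_sum_of_subset_of_nonneg (Finset.filter_subset _ _)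
        (fun A _ _ => by positivity))
    rw [Finset.mem_filter] at hk
    rw [Finset.prod_pow_eq_pow_sum, one_div, inv_pow, ← div_eq_mul_inv, one_le_div (by positivity)]
    apply pow_le_pow_right₀ (by norm_num)
    have : ∑ i, ((k i).natAbs : ℤ) ≤ ∑ i, (k i) ^ 2 := by
      apply Finset.sum_le_sum
      intro i _
      exact Int.natAbs_le_self_sq (k i)
    have := this.trans hk.2
    exact_mod_cast this
  refine h1.trans ?_
  rw [← Finset.mul_sum, ← Finset.prod_univ_sum (fun _ : ι =>
    Finset.Icc (-((4 * N : ℕ) : ℤ)) ((4 * N : ℕ) : ℤ)) (fun _ k => ((1 : ℝ) / 2) ^ (k.natAbs))]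
  rw [Finset.prod_const, Finset.card_univ, ← hN, pow_mul]
  have h2 := sum_half_pow (4 * N)
  have h3 : (0:ℝ) ≤ ∑ k ∈ Finset.Icc (-((4 * N : ℕ) : ℤ)) ((4 * N : ℕ) : ℤ),
    ((1 : ℝ) / 2) ^ (k.natAbs) := Finset.sum_nonneg (fun _ _ => by positivity)
  have h4 : (0:ℝ) ≤ 2 * (1/2) ^ (4 * N) := by positivity
  rw [← mul_pow]
  apply pow_le_pow_left₀ (by positivity)
  linarith

/-- Set of values of a tuple. -/
def img {n k : ℕ} (K : Fin k → Fin n) : Finset (Fin n) := Finset.univ.image K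

lemma card_img_le {n k : ℕ} (K : Fin k → Fin n) : (img K).card ≤ k := by
  have := Finset.card_image_le (s := Finset.univ) (f := K)
  simpa [img] using this

lemma card_fiber {n q : ℕ} (S : Finset (Fin n)) (hS : S.card = q) :
    (Finset.univ.filter fun K : Fin q → Fin n => img K = S).card = q.factorial := by
  have e : {K : Fin q → Fin n // img K = S} ≃ (Fin q ≃ S) :=
    { toFun := fun K => Equiv.ofBijective
        (fun i => ⟨K.1 i, by
          have h := K.2
          have : K.1 i ∈ img K.1 := by simp [img]
          rwa [h] at this⟩) (by
          rw [Fintype.bijective_iff_surjective_and_card]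
          refine ⟨?_, by simp [hS]⟩
          rintro ⟨s, hs⟩
          have h := K.2
          rw [← h] at hs
          simp only [img, Finset.mem_image, Finset.mem_univ, true_and] at hs
          obtain ⟨i, hi⟩ := hs
          exact ⟨i, Subtype.ext hi⟩)
      invFun := fun f => ⟨fun i => (f i : Fin n), by
        ext s
        simp only [img, Finset.mem_image, Finset.mem_univ, true_and]
        constructor
        · rintro ⟨i, rfl⟩; exact (f i).2
        · intro hs; exact ⟨f.symm ⟨s, hs⟩, by simp⟩⟩
      left_inv := fun K => by ext; rfl
      right_inv := fun f => by ext; rfl }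
  rw [← Fintype.card_subtype, Fintype.card_congr e,
    Fintype.card_equiv (Fintype.equivOfCardEq (by simp [hS]))]
  simp

lemma card_injTuples (n q : ℕ) :
    (Finset.univ.filter fun K : Fin q → Fin n => (img K).card = q).card =
      n.choose q * q.factorial := by
  rw [Finset.card_eq_sum_card_fiberwise (f := img)
    (t := Finset.powersetCard q (Finset.univ : Finset (Fin n)))]
  · rw [Finset.sum_congr rfl (g := fun _ => q.factorial)]
    · simp
    · intro S hS
      rw [Finset.mem_powersetCard] at hS
      rw [← card_fiber S hS.2, Finset.filter_filter]
      congr 1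
      ext K
      simp only [Finset.mem_filter, Finset.mem_univ, true_and, and_iff_right_iff_imp]
      rintro rfl
      exact hS.2
  · intro K hK
    simpa using hK

/-- Symmetrized coefficient. -/
noncomputable def bco {n q : ℕ} (A : (Fin q → Fin n) → ℝ) (S : Finset (Fin n)) : ℝ :=
  if S.card = q then
    (q.factorial : ℝ)⁻¹ * ∑ K ∈ Finset.univ.filter (fun K : Fin q → Fin n => img K = S), A K
  else 0

/-- Pairs of distinct injective tuples with the same value set. -/
def pairR (n q : ℕ) : Finset ((Fin q → Fin n) × (Fin q → Fin n)) :=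
  Finset.univ.filter fun p => p.1 ≠ p.2 ∧ img p.2 = img p.1 ∧ (img p.1).card = q

lemma card_pairR (n q : ℕ) :
    (pairR n q).card ≤ n.choose q * q.factorial * q.factorial := by
  rw [← card_injTuples]
  have : pairR n q ⊆ (Finset.univ.filter fun K : Fin q → Fin n => (img K).card = q).biUnion
      (fun K => (Finset.univ.filter fun L : Fin q → Fin n => img L = img K).image
        (fun L => (K, L))) := by
    rintro ⟨K, L⟩ h
    simp only [pairR, Finset.mem_filter, Finset.mem_univ, true_and] at h
    simp only [Finset.mem_biUnion, Finset.mem_filter, Finset.mem_univ, true_and,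
      Finset.mem_image]
    exact ⟨K, h.2.2, L, h.2.1, rfl⟩
  refine (Finset.card_le_card this).trans (Finset.card_biUnion_le_card_mul _ _ _ ?_)
  intro K hK
  refine Finset.card_image_le.trans ?_
  rw [card_fiber _ (Finset.mem_filter.mp hK).2]

lemma diag_value (n q : ℕ) (A : (Fin q → Fin n) → Bool) :
    ∑ K, sg (A K) * bco (fun K => sg (A K)) (img K) =
      n.choose q + (q.factorial : ℝ)⁻¹ * ∑ p ∈ pairR n q, sg (A p.1) * sg (A p.2) := by
  have hf : (q.factorial : ℝ) ≠ 0 := by positivity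
  have h1 : ∑ p ∈ pairR n q, sg (A p.1) * sg (A p.2) =
      ∑ K, ∑ L, if K ≠ L ∧ img L = img K ∧ (img K).card = q then sg (A K) * sg (A L) else 0 := by
    rw [pairR, Finset.sum_filter, Fintype.sum_prod_type]
  have h2 : (n.choose q : ℝ) = (q.factorial : ℝ)⁻¹ *
      ∑ K : Fin q → Fin n, ∑ L : Fin q → Fin n,
        if K = L ∧ (img K).card = q then sg (A K) * sg (A L) else 0 := by
    have : ∀ K : Fin q → Fin n, (∑ L : Fin q → Fin n,
        if K = L ∧ (img K).card = q then sg (A K) * sg (A L) else 0) =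
        if (img K).card = q then 1 else 0 := by
      intro K
      simp_rw [ite_and]
      rw [Finset.sum_ite_eq]
      simp [sg_sq]
    simp_rw [this]
    rw [Finset.sum_boole, card_injTuples]
    push_cast
    field_simp
  rw [h1, h2, ← mul_add, ← Finset.sum_add_distrib, Finset.mul_sum]
  apply Finset.sum_congr rfl
  intro K _
  rw [← Finset.sum_add_distrib, bco]
  split_ifs with hc
  · rw [mul_left_comm, Finset.sum_filter, Finset.mul_sum]
    congr 1
    apply Finset.sum_congr rfl
    intro L _
    by_cases hKL : K = L
    · subst hKL; simp [hc]
    · simp [hKL, hc]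
  · simp [hc]

/-- Index type: `h`-subsets. -/
abbrev SubH (n h : ℕ) := {s : Finset (Fin n) // s.card = h}

lemma card_Sub (n h : ℕ) : Fintype.card (SubH n h) = n.choose h := by
  simp [SubH]

noncomputable def tco {n h : ℕ} (u v : SubH n h → ℝ) (S : Finset (Fin n)) : ℝ :=
  ∑ p ∈ Finset.univ.filter (fun p : SubH n h × SubH n h => p.1.1 ∪ p.2.1 = S), u p.1 * v p.2

lemma bilin_eq_s13 {n h q : ℕ} (u v : SubH n h → ℝ) (A : (Fin q → Fin n) → ℝ) :
    ∑ g, ∑ g', u g * v g' * bco A (g.1 ∪ g'.1) =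
      ∑ K, (if (img K).card = q then (q.factorial : ℝ)⁻¹ * tco u v (img K) else 0) * A K := by
  have h1 : ∀ g g' : SubH n h, u g * v g' * bco A (g.1 ∪ g'.1) =
      ∑ K, if (img K).card = q ∧ g.1 ∪ g'.1 = img K then
        (q.factorial : ℝ)⁻¹ * (u g * v g') * A K else 0 := by
    intro g g'
    rw [bco]
    split_ifs with hc
    · rw [Finset.sum_filter, Finset.mul_sum, Finset.mul_sum]
      apply Finset.sum_congr rfl
      intro K _
      by_cases hK : img K = g.1 ∪ g'.1
      · simp [hK, hc]; ring
      · have : ¬ (g.1 ∪ g'.1 = img K) := fun h => hK h.symm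
        simp [hK, this]
    · rw [mul_zero]
      symm
      apply Finset.sum_eq_zero
      intro K _
      rw [if_neg]
      rintro ⟨a, b⟩
      rw [b] at hc
      exact hc a
  simp_rw [h1]
  rw [← Fintype.sum_prod_type' (f := fun g g' : SubH n h => ∑ K : Fin q → Fin n,
    if (img K).card = q ∧ g.1 ∪ g'.1 = img K then
        (q.factorial : ℝ)⁻¹ * (u g * v g') * A K else 0), Finset.sum_comm]
  apply Finset.sum_congr rfl
  intro K _
  split_ifs with hc
  · rw [tco, Finset.sum_filter, Finset.mul_sum, Finset.sum_mul]
    apply Finset.sum_congr rfl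
    intro p _
    by_cases hp : p.1.1 ∪ p.2.1 = img K
    · simp [hp, hc]
    · simp [hp]
  · simp [hc]

lemma tco_sq_le {n h : ℕ} (u v : SubH n h → ℝ) (S : Finset (Fin n)) (hS : S.card = 2 * h) :
    tco u v S ^ 2 ≤ ((2 * h).choose h : ℝ) *
      ∑ p ∈ Finset.univ.filter (fun p : SubH n h × SubH n h => p.1.1 ∪ p.2.1 = S),
        (u p.1 * v p.2) ^ 2 := by
  refine sq_sum_le_card_mul_sum_sq.trans ?_
  gcongr
  rw [← hS, ← Finset.card_powersetCard]
  apply Finset.card_le_card_of_injOn (fun p => p.1.1)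
  · intro p hp
    simp only [Finset.coe_filter, Finset.mem_univ, true_and, Set.mem_ofPred_eq] at hp
    rw [Finset.mem_coe, Finset.mem_powersetCard]
    exact ⟨hp ▸ Finset.subset_union_left, p.1.2⟩
  · intro p hp p' hp' he
    simp only [Finset.coe_filter, Finset.mem_univ, true_and, Set.mem_ofPred_eq] at hp hp'
    have key : ∀ r : SubH n h × SubH n h, r.1.1 ∪ r.2.1 = S → r.2.1 = S \ r.1.1 := by
      intro r hr
      have hd : Disjoint r.1.1 r.2.1 := by
        rw [← Finset.card_union_eq_card_add_card, hr, hS, r.1.2, r.2.2]; ring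
      rw [← hr, Finset.union_sdiff_cancel_left hd]
    have a := key p hp
    have b := key p' hp'
    simp only at he
    rw [he] at a
    exact Prod.ext (Subtype.ext he) (Subtype.ext (a.trans b.symm))

lemma coef_sq_le_s13 {n h q : ℕ} (hq : q = 2 * h) (u v : SubH n h → ℝ) :
    ∑ K : Fin q → Fin n,
      (if (img K).card = q then (q.factorial : ℝ)⁻¹ * tco u v (img K) else 0) ^ 2 ≤
      (∑ g, u g ^ 2) * (∑ g, v g ^ 2) / (h.factorial : ℝ) ^ 2 := by
  have hf : (0:ℝ) < (q.factorial : ℝ) := by positivity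
  have h1 : ∑ K : Fin q → Fin n,
      (if (img K).card = q then (q.factorial : ℝ)⁻¹ * tco u v (img K) else 0) ^ 2 =
      ∑ S : Finset (Fin n), if S.card = q then (q.factorial : ℝ)⁻¹ * tco u v S ^ 2 else 0 := by
    rw [← Finset.sum_fiberwise (s := Finset.univ) (g := img)]
    apply Finset.sum_congr rfl
    intro S _
    rw [Finset.sum_congr rfl (g := fun _ =>
      (if S.card = q then (q.factorial : ℝ)⁻¹ * tco u v S else 0) ^ 2)]
    · rw [Finset.sum_const]
      split_ifs with hS
      · rw [card_fiber S hS, nsmul_eq_mul]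
        field_simp
      · simp
    · intro K hK
      rw [(Finset.mem_filter.mp hK).2]
  rw [h1]
  have h2 : ∀ S : Finset (Fin n),
      (if S.card = q then (q.factorial : ℝ)⁻¹ * tco u v S ^ 2 else 0) ≤
      (q.factorial : ℝ)⁻¹ * ((2 * h).choose h : ℝ) *
      ∑ p ∈ Finset.univ.filter (fun p : SubH n h × SubH n h => p.1.1 ∪ p.2.1 = S),
        (u p.1 * v p.2) ^ 2 := by
    intro S
    split_ifs with hS
    · rw [mul_assoc]
      gcongr
      exact tco_sq_le u v S (hS.trans hq)
    · have := Finset.sum_nonneg (s := Finset.univ.filter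
        (fun p : SubH n h × SubH n h => p.1.1 ∪ p.2.1 = S))
        (f := fun p => (u p.1 * v p.2) ^ 2) (fun _ _ => sq_nonneg _)
      positivity
  refine (Finset.sum_le_sum (fun S _ => h2 S)).trans ?_
  rw [← Finset.mul_sum, Finset.sum_fiberwise, Fintype.sum_prod_type]
  simp_rw [mul_pow]
  rw [← Finset.sum_mul_sum]
  have h3 : (q.factorial : ℝ)⁻¹ * ((2 * h).choose h : ℝ) = 1 / (h.factorial : ℝ) ^ 2 := by
    have := Nat.choose_mul_factorial_mul_factorial (show h ≤ 2 * h by omega)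
    rw [show 2 * h - h = h by omega, ← hq] at this
    have h' : (((q).choose h : ℝ)) * h.factorial * h.factorial = q.factorial := by
      exact_mod_cast this
    rw [← hq, ← h']
    have : (0:ℝ) < (q.choose h : ℝ) := by
      have := Nat.choose_pos (show h ≤ q by omega)
      exact_mod_cast this
    field_simp
  rw [h3]
  apply le_of_eq
  ring

noncomputable def lam (n h : ℕ) : ℝ := 18 * √(n.choose h : ℝ) / h.factorial

/-- The good event for the quadratic form. -/
def goodNet (n h q : ℕ) (A : (Fin q → Fin n) → Bool) : Prop :=
  ∀ k ∈ intNet (SubH n h), ∀ k' ∈ intNet (SubH n h),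
    -(∑ g, ∑ g', (k g : ℝ) * k' g' * bco (fun K => sg (A K)) (g.1 ∪ g'.1)) ≤
      lam n h * n.choose h

open Classical in
lemma badNet_count (n h q : ℕ) (hq : q = 2 * h) (hN : 0 < n.choose h) :
    ((Finset.univ.filter fun A : (Fin q → Fin n) → Bool => ¬ goodNet n h q A).card : ℝ) ≤
      (1 / 2) ^ (n.choose h) * (Fintype.card ((Fin q → Fin n) → Bool) : ℝ) := by
  set N := n.choose h with hNdef
  have hNR : (0:ℝ) < N := by exact_mod_cast hN
  have hcN : Fintype.card (SubH n h) = N := card_Sub n h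
  set net := intNet (SubH n h) with hnet
  set a : (SubH n h → ℤ) × (SubH n h → ℤ) → (Fin q → Fin n) → ℝ := fun p K =>
    - (if (img K).card = q then (q.factorial : ℝ)⁻¹ *
      tco (fun g => (p.1 g : ℝ)) (fun g => (p.2 g : ℝ)) (img K) else 0) with ha
  have hsub : (Finset.univ.filter fun A : (Fin q → Fin n) → Bool => ¬ goodNet n h q A) ⊆
      (net ×ˢ net).biUnion (fun p => Finset.univ.filter
        fun A : (Fin q → Fin n) → Bool => lam n h * N ≤ ∑ K, a p K * sg (A K)) := by
    intro A hA
    have hA := (Finset.mem_filter.mp hA).2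
    unfold goodNet at hA
    push Not at hA
    obtain ⟨k, hk, k', hk', hlt⟩ := hA
    rw [Finset.mem_biUnion]
    refine ⟨(k, k'), Finset.mk_mem_product hk hk', ?_⟩
    rw [Finset.mem_filter]
    refine ⟨Finset.mem_univ _, ?_⟩
    rw [bilin_eq_s13] at hlt
    rw [← Finset.sum_neg_distrib] at hlt
    refine hlt.le.trans (le_of_eq (Finset.sum_congr rfl (fun K _ => ?_)))
    rw [ha]
    ring
  have hfac : (0:ℝ) < (h.factorial : ℝ) := by positivity
  have hone : ∀ p ∈ net ×ˢ net, ((Finset.univ.filter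
        fun A : (Fin q → Fin n) → Bool => lam n h * N ≤ ∑ K, a p K * sg (A K)).card : ℝ) ≤
      Real.exp (-10) ^ N * (Fintype.card ((Fin q → Fin n) → Bool) : ℝ) := by
    intro p hp
    rw [Finset.mem_product, hnet, mem_intNet, mem_intNet, hcN] at hp
    have hV : ∑ K, a p K ^ 2 ≤ 16 * (N:ℝ) ^ 2 / (h.factorial : ℝ) ^ 2 := by
      have := coef_sq_le_s13 hq (fun g => (p.1 g : ℝ)) (fun g => (p.2 g : ℝ))
      simp only [ha, neg_sq]
      refine this.trans ?_
      apply div_le_div_of_nonneg_right _ (by positivity)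
      calc _ ≤ (4 * (N:ℝ)) * (4 * N) := by
            apply mul_le_mul hp.1 hp.2 (Finset.sum_nonneg (fun _ _ => sq_nonneg _)) (by positivity)
        _ = _ := by ring
    have := hoeffding_count (a p) (lam n h * N) _ hV (by positivity)
      (by unfold lam; positivity)
    refine this.trans ?_
    gcongr
    rw [← Real.exp_nat_mul]
    apply Real.exp_le_exp.mpr
    have hs : √(N:ℝ) ^ 2 = N := Real.sq_sqrt hNR.le
    have : (lam n h * N) ^ 2 / (2 * (16 * (N:ℝ) ^ 2 / (h.factorial : ℝ) ^ 2)) =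
        (81 / 8) * N := by
      rw [lam, ← hNdef]
      field_simp
      rw [hs]
      ring
    rw [this]
    linarith
  calc _ ≤ (((net ×ˢ net).biUnion (fun p => Finset.univ.filter
        fun A : (Fin q → Fin n) → Bool => lam n h * N ≤ ∑ K, a p K * sg (A K))).card : ℝ) := by
          exact_mod_cast Finset.card_le_card hsub
    _ ≤ ∑ p ∈ net ×ˢ net, ((Finset.univ.filter
        fun A : (Fin q → Fin n) → Bool => lam n h * N ≤ ∑ K, a p K * sg (A K)).card : ℝ) := by
          exact_mod_cast Finset.card_biUnion_le
    _ ≤ ∑ p ∈ net ×ˢ net, Real.exp (-10) ^ N *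
          (Fintype.card ((Fin q → Fin n) → Bool) : ℝ) := Finset.sum_le_sum hone
    _ = (net.card : ℝ) * net.card * (Real.exp (-10) ^ N *
          (Fintype.card ((Fin q → Fin n) → Bool) : ℝ)) := by
          rw [Finset.sum_const, Finset.card_product, nsmul_eq_mul]; push_cast; ring
    _ ≤ 48 ^ N * 48 ^ N * (Real.exp (-10) ^ N *
          (Fintype.card ((Fin q → Fin n) → Bool) : ℝ)) := by
          have := card_intNet (SubH n h)
          rw [hcN] at this
          gcongr
    _ = (48 * 48 * Real.exp (-10)) ^ N * (Fintype.card ((Fin q → Fin n) → Bool) : ℝ) := by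
          rw [mul_pow, mul_pow]; ring
    _ ≤ _ := by
          gcongr
          have h1 : (2.7 : ℝ) ^ 10 ≤ Real.exp 10 := by
            have := Real.exp_one_gt_d9
            rw [show (10:ℝ) = ((10:ℕ) : ℝ) * 1 by norm_num, Real.exp_nat_mul]
            apply pow_le_pow_left₀ (by norm_num)
            linarith
          rw [Real.exp_neg, ← div_eq_mul_inv, div_le_iff₀ (Real.exp_pos _)]
          have : (4608 : ℝ) ≤ 2.7 ^ 10 := by norm_num
          linarith

lemma goodNet_quad {n h q : ℕ} (hN : 0 < n.choose h) (A : (Fin q → Fin n) → Bool)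
    (hA : goodNet n h q A) (z : SubH n h → ℝ) :
    -(∑ g, ∑ g', z g * z g' * bco (fun K => sg (A K)) (g.1 ∪ g'.1)) ≤
      lam n h * ∑ g, z g ^ 2 := by
  set b := bco (fun K => sg (A K)) with hb
  have hNR : (0:ℝ) < n.choose h := by exact_mod_cast hN
  -- normalized version
  have key : ∀ w : SubH n h → ℝ, ∑ g, w g ^ 2 ≤ n.choose h →
      -(∑ g, ∑ g', w g * w g' * b (g.1 ∪ g'.1)) ≤ lam n h * n.choose h := by
    intro w hw
    rw [← card_Sub n h] at hw
    obtain ⟨k, hk, hk2⟩ := round_int (fun g => -∑ g', w g' * b (g.1 ∪ g'.1)) w hw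
    obtain ⟨k', hk', hk2'⟩ := round_int (fun g' => -∑ g, k g * b (g.1 ∪ g'.1)) w hw
    have := hA k ((mem_intNet k).mpr hk) k' ((mem_intNet k').mpr hk')
    refine le_trans (le_trans (le_of_eq ?_) hk2)
      (le_trans (le_trans (le_of_eq ?_) hk2') (le_trans (le_of_eq ?_) this))
    · rw [← Finset.sum_neg_distrib]
      refine Finset.sum_congr rfl (fun g _ => ?_)
      rw [neg_mul, Finset.sum_mul]
      congr 1
      exact Finset.sum_congr rfl (fun g' _ => by ring)
    · simp_rw [neg_mul, Finset.sum_neg_distrib, Finset.sum_mul]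
      rw [Finset.sum_comm]
      congr 1
      exact Finset.sum_congr rfl (fun g' _ => Finset.sum_congr rfl (fun g _ => by ring))
    · simp_rw [neg_mul, Finset.sum_neg_distrib, Finset.sum_mul]
      rw [Finset.sum_comm]
      congr 1
      exact Finset.sum_congr rfl (fun g' _ => Finset.sum_congr rfl (fun g _ => by ring))
  by_cases h0 : ∑ g, z g ^ 2 = 0
  · have hz : ∀ g, z g = 0 := by
      intro g
      have := (Finset.sum_eq_zero_iff_of_nonneg (fun g _ => sq_nonneg (z g))).mp h0 g
        (Finset.mem_univ g)
      exact pow_eq_zero_iff (two_ne_zero) |>.mp this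
    simp [hz]
  · have hpos : 0 < ∑ g, z g ^ 2 :=
      lt_of_le_of_ne (Finset.sum_nonneg (fun _ _ => sq_nonneg _)) (Ne.symm h0)
    set Z := ∑ g, z g ^ 2 with hZ
    set r := √((n.choose h : ℝ) / Z) with hr
    have hr2 : r ^ 2 = (n.choose h : ℝ) / Z := Real.sq_sqrt (by positivity)
    have h1 := key (fun g => r * z g) (by
      simp_rw [mul_pow]
      rw [← Finset.mul_sum, ← hZ, hr2]
      apply le_of_eq; field_simp)
    have h2 : ∑ g, ∑ g', (r * z g) * (r * z g') * b (g.1 ∪ g'.1) =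
        r ^ 2 * ∑ g, ∑ g', z g * z g' * b (g.1 ∪ g'.1) := by
      simp_rw [Finset.mul_sum]
      exact Finset.sum_congr rfl (fun g' _ => Finset.sum_congr rfl (fun g _ => by ring))
    rw [h2, hr2] at h1
    set F := ∑ g, ∑ g', z g * z g' * b (g.1 ∪ g'.1)
    have h3 : -F * ((n.choose h : ℝ) / Z) ≤ lam n h * Z * ((n.choose h : ℝ) / Z) := by
      have : lam n h * Z * ((n.choose h : ℝ) / Z) = lam n h * n.choose h := by field_simp
      rw [this]; linarith
    exact le_of_mul_le_mul_right h3 (by positivity)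

/-- Values occurring an odd number of times. -/
def oddS {n k : ℕ} (I : Fin k → Fin n) : Finset (Fin n) :=
  Finset.univ.filter fun v => ¬ Even (cnt I v)

lemma cnt_eq_zero {n k : ℕ} (I : Fin k → Fin n) (v : Fin n) : cnt I v = 0 ↔ v ∉ img I := by
  simp [cnt, img, Finset.filter_eq_empty_iff]

lemma oddS_sub_img {n k : ℕ} (I : Fin k → Fin n) : oddS I ⊆ img I := by
  intro v hv
  by_contra h
  rw [← cnt_eq_zero] at h
  simp [oddS, h] at hv

lemma oddS_iff {n h : ℕ} (I : Fin h → Fin n) (T : Finset (Fin n)) (hT : T.card = h) :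
    oddS I = T ↔ img I = T := by
  constructor
  · rintro rfl
    symm
    apply Finset.eq_of_subset_of_card_le (oddS_sub_img I)
    rw [hT]
    exact card_img_le I
  · intro hI
    have hinj : Function.Injective I := by
      have : (Finset.univ.image I).card = (Finset.univ : Finset (Fin h)).card := by
        change (img I).card = _
        rw [hI, hT]; simp
      have := Finset.card_image_iff.mp this
      simpa using this
    rw [← hI]
    apply Finset.Subset.antisymm (oddS_sub_img I)
    intro v hv
    have h1 : cnt I v ≠ 0 := by rw [Ne, cnt_eq_zero]; simpa using hv
    have h2 : cnt I v ≤ 1 := by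
      rw [cnt, Finset.card_le_one]
      intro a ha b hb
      simp only [Finset.mem_filter, Finset.mem_univ, true_and] at ha hb
      exact hinj (ha.trans hb.symm)
    have h3 : cnt I v = 1 := by omega
    simp [oddS, h3]

/-- Fiber sums. -/
noncomputable def zfib {n h : ℕ} (y : (Fin h → Fin n) → ℝ) (S : Finset (Fin n)) : ℝ :=
  ∑ I ∈ Finset.univ.filter (fun I : Fin h → Fin n => img I = S), y I

lemma sum_SubH {n h : ℕ} (f : Finset (Fin n) → ℝ) :
    ∑ S ∈ Finset.univ.filter (fun S : Finset (Fin n) => S.card = h), f S =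
      ∑ g : SubH n h, f g.1 :=
  Finset.sum_subtype _ (fun x => by simp) f

lemma odd_form {n h : ℕ} (y : (Fin h → Fin n) → ℝ) :
    ∑ g : SubH n h, zfib y g.1 ^ 2 ≤
      ∑ I, ∑ J, y I * (if oddS I = oddS J then 1 else 0) * y J := by
  have h1 : ∑ I, ∑ J, y I * (if oddS I = oddS J then 1 else 0) * y J =
      ∑ T : Finset (Fin n),
        (∑ I ∈ Finset.univ.filter (fun I : Fin h → Fin n => oddS I = T), y I) ^ 2 := by
    rw [← Finset.sum_fiberwise (s := Finset.univ) (g := fun I : Fin h → Fin n => oddS I)]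
    apply Finset.sum_congr rfl
    intro T _
    rw [sq, Finset.sum_mul]
    apply Finset.sum_congr rfl
    intro I hI
    rw [Finset.sum_filter, Finset.mul_sum, (Finset.mem_filter.mp hI).2]
    apply Finset.sum_congr rfl
    intro J _
    by_cases hJ : oddS J = T
    · simp [hJ]
    · simp [hJ, Ne.symm hJ]
  rw [h1, ← sum_SubH (fun S => zfib y S ^ 2)]
  refine le_trans (le_of_eq (Finset.sum_congr rfl (fun S hS => ?_)))
    (Finset.sum_le_sum_of_subset_of_nonneg (Finset.subset_univ _) (fun _ _ _ => sq_nonneg _))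
  rw [zfib]
  congr 1
  apply Finset.sum_congr _ (fun _ _ => rfl)
  ext I
  simp only [Finset.mem_filter, Finset.mem_univ, true_and]
  exact (oddS_iff I S (Finset.mem_filter.mp hS).2).symm

lemma zfib_zero {n h : ℕ} (y : (Fin h → Fin n) → ℝ) (S : Finset (Fin n)) (hS : h < S.card) :
    zfib y S = 0 := by
  rw [zfib, Finset.filter_eq_empty_iff.mpr, Finset.sum_empty]
  rintro I - rfl
  have := card_img_le I
  omega

lemma bco_form {n h q : ℕ} (hq : q = 2 * h) (A : (Fin q → Fin n) → ℝ)
    (y : (Fin h → Fin n) → ℝ) :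
    ∑ I, ∑ J, y I * bco A (img I ∪ img J) * y J =
      ∑ g : SubH n h, ∑ g' : SubH n h, zfib y g.1 * zfib y g'.1 * bco A (g.1 ∪ g'.1) := by
  have h1 : ∑ I, ∑ J, y I * bco A (img I ∪ img J) * y J =
      ∑ S : Finset (Fin n), ∑ S' : Finset (Fin n), zfib y S * zfib y S' * bco A (S ∪ S') := by
    rw [← Finset.sum_fiberwise (s := Finset.univ) (g := fun I : Fin h → Fin n => img I)]
    apply Finset.sum_congr rfl
    intro S _
    simp_rw [← Finset.sum_fiberwise (s := Finset.univ) (g := fun I : Fin h → Fin n => img I)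
      (f := fun J => y _ * bco A (img _ ∪ img J) * y J)]
    rw [Finset.sum_comm]
    apply Finset.sum_congr rfl
    intro S' _
    rw [zfib, zfib, Finset.sum_mul_sum, Finset.sum_mul]
    apply Finset.sum_congr rfl
    intro I hI
    rw [Finset.sum_mul]
    apply Finset.sum_congr rfl
    intro J hJ
    rw [(Finset.mem_filter.mp hI).2, (Finset.mem_filter.mp hJ).2]
    ring
  rw [h1]
  have h0 : ∀ S S' : Finset (Fin n), ¬ (S.card = h ∧ S'.card = h) →
      zfib y S * zfib y S' * bco A (S ∪ S') = 0 := by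
    intro S S' hne
    by_cases a : h < S.card
    · rw [zfib_zero y S a]; ring
    by_cases b : h < S'.card
    · rw [zfib_zero y S' b]; ring
    have := Finset.card_union_le S S'
    rw [bco, if_neg (by omega)]; ring
  rw [← sum_SubH (fun S => ∑ g' : SubH n h, zfib y S * zfib y g'.1 * bco A (S ∪ g'.1))]
  rw [← Finset.sum_subset (Finset.subset_univ
    (Finset.univ.filter (fun S : Finset (Fin n) => S.card = h)))]
  · apply Finset.sum_congr rfl
    intro S _
    rw [← sum_SubH (fun S' => zfib y S * zfib y S' * bco A (S ∪ S'))]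
    symm
    apply Finset.sum_subset (Finset.subset_univ _)
    intro S' _ hS'
    apply h0
    simp only [Finset.mem_filter, Finset.mem_univ, true_and] at hS'
    tauto
  · intro S _ hS
    apply Finset.sum_eq_zero
    intro S' _
    apply h0
    simp only [Finset.mem_filter, Finset.mem_univ, true_and] at hS
    tauto

/-- Splitting positions. -/
def posE (q : ℕ) (hq : q % 2 = 0) : Fin (q / 2) ⊕ Fin (q / 2) ≃ Fin q :=
  finSumFinEquiv.trans (finCongr (by omega))

lemma tupConcat_comp {n : ℕ} (q : ℕ) (hq : q % 2 = 0) (I J : Fin (q / 2) → Fin n) :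
    tupConcat q hq I J ∘ posE q hq = Sum.elim I J := by
  ext x
  rcases x with i | i
  · simp [tupConcat, posE]
  · simp [tupConcat, posE]

lemma sum_tupConcat {n : ℕ} (q : ℕ) (hq : q % 2 = 0) (F : (Fin q → Fin n) → ℝ) :
    ∑ I, ∑ J, F (tupConcat q hq I J) = ∑ K, F K := by
  rw [← Fintype.sum_prod_type' (f := fun I J => F (tupConcat q hq I J))]
  let e : ((Fin (q / 2) → Fin n) × (Fin (q / 2) → Fin n)) ≃ (Fin q → Fin n) :=
    (Equiv.sumArrowEquivProdArrow _ _ _).symm.trans ((posE q hq).arrowCongr (Equiv.refl _))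
  rw [← Equiv.sum_comp e]
  apply Finset.sum_congr rfl
  rintro ⟨I, J⟩ _
  congr 1
  have h := tupConcat_comp q hq I J
  have h2 : tupConcat q hq I J = Sum.elim I J ∘ (posE q hq).symm := by
    rw [← h]; ext x; simp
  rw [h2]
  rfl

lemma cnt_tupConcat {n : ℕ} (q : ℕ) (hq : q % 2 = 0) (I J : Fin (q / 2) → Fin n) (v : Fin n) :
    cnt (tupConcat q hq I J) v = cnt I v + cnt J v := by
  simp only [cnt, Finset.card_filter]
  rw [← Equiv.sum_comp (posE q hq), Fintype.sum_sum_type]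
  have h := tupConcat_comp q hq I J
  congr 1
  · apply Finset.sum_congr rfl
    intro i _
    have := congrFun h (Sum.inl i)
    simp only [Function.comp_apply, Sum.elim_inl] at this
    rw [this]
  · apply Finset.sum_congr rfl
    intro i _
    have := congrFun h (Sum.inr i)
    simp only [Function.comp_apply, Sum.elim_inr] at this
    rw [this]

lemma mem_img_iff {n k : ℕ} (I : Fin k → Fin n) (v : Fin n) : v ∈ img I ↔ cnt I v ≠ 0 := by
  rw [Ne, cnt_eq_zero, not_not]

lemma mem_union_img {n k : ℕ} (I J : Fin k → Fin n) (v : Fin n) :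
    v ∈ img I ∪ img J ↔ cnt I v + cnt J v ≠ 0 := by
  rw [Finset.mem_union, mem_img_iff, mem_img_iff]; omega

lemma img_tupConcat {n : ℕ} (q : ℕ) (hq : q % 2 = 0) (I J : Fin (q / 2) → Fin n) :
    img (tupConcat q hq I J) = img I ∪ img J := by
  ext v
  rw [mem_union_img, mem_img_iff, cnt_tupConcat]

lemma oddS_eq_iff {n k : ℕ} (I J : Fin k → Fin n) :
    oddS I = oddS J ↔ ∀ v, Even (cnt I v + cnt J v) := by
  simp only [oddS, Finset.ext_iff, Finset.mem_filter, Finset.mem_univ, true_and, Nat.even_add]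
  exact forall_congr' (fun v => not_iff_not)

lemma oddS_tupConcat {n : ℕ} (q : ℕ) (hq : q % 2 = 0) (I J : Fin (q / 2) → Fin n) :
    oddS (tupConcat q hq I J) = ∅ ↔ oddS I = oddS J := by
  rw [oddS_eq_iff, oddS, Finset.filter_eq_empty_iff]
  simp [cnt_tupConcat]

lemma cnt_succ {n m : ℕ} (K : Fin (m + 1) → Fin n) (v : Fin n) :
    cnt K v = (if K 0 = v then 1 else 0) + cnt (Fin.tail K) v := by
  simp only [cnt, Finset.card_filter]
  rw [Fin.sum_univ_succ]
  rfl

lemma even_count (n m : ℕ) :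
    (Finset.univ.filter fun K : Fin (m + 1) → Fin n => oddS K = ∅).card ≤ n ^ m := by
  have : (Finset.univ : Finset (Fin m → Fin n)).card = n ^ m := by simp
  rw [← this]
  apply Finset.card_le_card_of_injOn Fin.tail
  · intro _ _; simp
  · intro K hK K' hK' he
    have hK := (Finset.mem_filter.mp hK).2
    have hK' := (Finset.mem_filter.mp hK').2
    rw [oddS, Finset.filter_eq_empty_iff] at hK hK'
    have a := hK (Finset.mem_univ (K 0))
    have b := hK' (Finset.mem_univ (K 0))
    rw [not_not, cnt_succ] at a b
    rw [he] at a
    have h0 : K' 0 = K 0 := by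
      by_contra hne
      rw [if_neg hne] at b
      rw [if_pos rfl] at a
      rw [Nat.even_add] at a
      have : Even (cnt (Fin.tail K') (K 0)) := by simpa using b
      exact absurd (a.mpr this) (by decide)
    rw [← Fin.cons_self_tail K, ← Fin.cons_self_tail K', he, h0]

/-- The property in the statement. -/
def goodM (n q : ℕ) (hqe : q % 2 = 0) (t : ℝ) (A : (Fin q → Fin n) → ℝ) : Prop :=
  ∃ M : (Fin (q / 2) → Fin n) → (Fin (q / 2) → Fin n) → ℝ,
            (∀ I J, M I J = M J I) ∧
            (∀ y : (Fin (q / 2) → Fin n) → ℝ,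
              0 ≤ ∑ I, ∑ J, y I * M I J * y J) ∧
            (∀ I J K L : Fin (q / 2) → Fin n,
              (∀ v, cnt I v + cnt J v = cnt K v + cnt L v) → M I J = M K L) ∧
            (∑ I, M I I) = 1 ∧
            t ≤ ∑ I, ∑ J, A (tupConcat q hqe I J) * M I J

lemma goodM_of_good {n q : ℕ} (hq2 : 2 ≤ q) (hqe : q % 2 = 0) (hn : 0 < n)
    (hN : 0 < n.choose (q / 2))
    (A : (Fin q → Fin n) → Bool) (hA : goodNet n (q / 2) q A) (D E : ℝ)
    (hD : D ≤ ∑ K, sg (A K) * bco (fun K => sg (A K)) (img K))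
    (hE : E ≤ ∑ K, sg (A K) * (if oddS K = ∅ then 1 else 0)) :
    goodM n q hqe (D / (lam n (q / 2) * n ^ (q / 2)) + E / n ^ (q / 2))
      (fun K => sg (A K)) := by
  set l := lam n (q / 2) with hl
  set b := bco (fun K => sg (A K)) with hb
  have hNR : (0:ℝ) < n.choose (q / 2) := by exact_mod_cast hN
  have hnR : (0:ℝ) < n := by exact_mod_cast hn
  have hlpos : 0 < l := by rw [hl, lam]; positivity
  have hc : (0:ℝ) < l * n ^ (q / 2) := by positivity
  refine ⟨fun I J => (l * n ^ (q / 2))⁻¹ *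
    (b (img I ∪ img J) + l * (if oddS I = oddS J then 1 else 0)), ?_, ?_, ?_, ?_, ?_⟩
  · intro I J
    dsimp only
    rw [Finset.union_comm (img I) (img J)]
    by_cases h : oddS I = oddS J
    · simp [h]
    · simp [h, Ne.symm h]
  · intro y
    have e : ∑ I, ∑ J, y I * ((l * n ^ (q / 2))⁻¹ *
        (b (img I ∪ img J) + l * (if oddS I = oddS J then 1 else 0))) * y J =
        (l * n ^ (q / 2))⁻¹ * ((∑ I, ∑ J, y I * b (img I ∪ img J) * y J) +
          l * ∑ I, ∑ J, y I * (if oddS I = oddS J then 1 else 0) * y J) := by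
      simp only [Finset.mul_sum, mul_add, ← Finset.sum_add_distrib]
      exact Finset.sum_congr rfl (fun I _ => Finset.sum_congr rfl (fun J _ => by ring))
    rw [e]
    apply mul_nonneg (inv_nonneg.mpr hc.le)
    rw [hb, bco_form (by omega)]
    have h1 := goodNet_quad hN A hA (fun g => zfib y g.1)
    have h2 := mul_le_mul_of_nonneg_left (odd_form y) hlpos.le
    linarith
  · intro I J K L hv
    have h1 : img I ∪ img J = img K ∪ img L := by
      ext v; rw [mem_union_img, mem_union_img, hv]
    have h2 : (oddS I = oddS J) ↔ (oddS K = oddS L) := by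
      rw [oddS_eq_iff, oddS_eq_iff]; simp only [hv]
    simp only [h1, h2]
  · have h1 : ∀ I : Fin (q / 2) → Fin n, b (img I ∪ img I) = 0 := by
      intro I
      rw [hb, bco, if_neg]
      have := card_img_le I
      rw [Finset.union_self]
      omega
    simp only [h1, if_true, Finset.sum_const, Finset.card_univ, nsmul_eq_mul]
    simp
    field_simp
  · have e : ∑ I, ∑ J, sg (A (tupConcat q hqe I J)) * ((l * n ^ (q / 2))⁻¹ *
        (b (img I ∪ img J) + l * (if oddS I = oddS J then 1 else 0))) =
        ∑ K, sg (A K) * ((l * n ^ (q / 2))⁻¹ * (b (img K) +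
          l * (if oddS K = ∅ then 1 else 0))) := by
      rw [← sum_tupConcat q hqe]
      simp only [img_tupConcat, oddS_tupConcat]
    have e2 : ∑ K, sg (A K) * ((l * n ^ (q / 2))⁻¹ * (b (img K) +
          l * (if oddS K = ∅ then 1 else 0))) =
        (∑ K, sg (A K) * b (img K)) / (l * n ^ (q / 2)) +
        (∑ K, sg (A K) * (if oddS K = ∅ then 1 else 0)) / n ^ (q / 2) := by
      rw [Finset.sum_div, Finset.sum_div, ← Finset.sum_add_distrib]
      apply Finset.sum_congr rfl
      intro K _
      field_simp
    rw [e, e2]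
    gcongr

lemma goodM_of_diag {n q : ℕ} (hqe : q % 2 = 0) (j : Fin n)
    (A : (Fin q → Fin n) → Bool) (hA : A (fun _ => j) = true) :
    goodM n q hqe 1 (fun K => sg (A K)) := by
  have hconst : ∀ k : ℕ, ∀ I : Fin k → Fin n, (∀ v, v ≠ j → cnt I v = 0) ↔ I = fun _ => j := by
    intro k I
    constructor
    · intro h
      ext i
      by_contra hne
      have := h (I i) (fun hh => hne (by rw [hh]))
      rw [cnt_eq_zero] at this
      exact this (by simp [img])
    · rintro rfl v hv
      rw [cnt_eq_zero]
      simp only [img, Finset.mem_image, Finset.mem_univ, true_and, not_exists]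
      intro _ hh; exact hv hh.symm
  set c : Fin (q / 2) → Fin n := fun _ => j with hcdef
  have hM : ∀ I J : Fin (q / 2) → Fin n,
      (∀ v, v ≠ j → cnt I v + cnt J v = 0) ↔ (I = c ∧ J = c) := by
    intro I J
    rw [← hconst, ← hconst]
    constructor
    · intro h
      exact ⟨fun v hv => by have := h v hv; omega, fun v hv => by have := h v hv; omega⟩
    · rintro ⟨h1, h2⟩ v hv
      rw [h1 v hv, h2 v hv]
  refine ⟨fun I J => if I = c ∧ J = c then 1 else 0, ?_, ?_, ?_, ?_, ?_⟩
  · intro I J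
    simp only [and_comm]
  · intro y
    have : ∑ I, ∑ J, y I * (if I = c ∧ J = c then 1 else 0) * y J = y c * y c := by
      simp [ite_and]
    rw [this]
    exact mul_self_nonneg _
  · intro I J K L hv
    have : (I = c ∧ J = c) ↔ (K = c ∧ L = c) := by
      rw [← hM, ← hM]; simp only [hv]
    simp only [this]
  · simp
  · have : ∑ I, ∑ J, sg (A (tupConcat q hqe I J)) * (if I = c ∧ J = c then 1 else 0) =
        sg (A (tupConcat q hqe c c)) := by
      simp [ite_and]
    rw [this]
    have h2 : tupConcat q hqe c c = fun _ => j := by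
      ext x; simp [tupConcat, hcdef]
    rw [h2, hA]
    simp [sg]

lemma le_choose_self (n : ℕ) : ∀ k, 1 ≤ k → k + 1 ≤ n → n ≤ n.choose k := by
  induction n with
  | zero => intro k _ h; omega
  | succ n ih =>
    intro k hk hkn
    obtain ⟨k, rfl⟩ : ∃ k', k = k' + 1 := ⟨k - 1, by omega⟩
    rw [Nat.choose_succ_succ]
    rcases Nat.eq_zero_or_pos k with h0 | h0
    · subst h0; simp
    · have a := ih k h0 (by omega)
      have b := Nat.choose_pos (show k + 1 ≤ n by omega)
      simp only [Nat.succ_eq_add_one] at *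
      omega

lemma exp_half_le (n : ℕ) (hn : 0 < n) : Real.exp (-((n : ℝ) / 2)) ≤ 1 / n := by
  have hnR : (0:ℝ) < n := by exact_mod_cast hn
  rw [Real.exp_neg, ← one_div]
  apply one_div_le_one_div_of_le hnR
  have h1 := Real.add_one_le_exp ((n:ℝ) / 2 - 1)
  have h2 : Real.exp ((n:ℝ) / 2) = Real.exp ((n:ℝ) / 2 - 1) * Real.exp 1 := by
    rw [← Real.exp_add]; congr 1; ring
  have h3 := Real.exp_one_gt_d9
  rw [h2]
  nlinarith

open Classical in
lemma tprob_ge {n q : ℕ} (P : ((Fin q → Fin n) → ℝ) → Prop) (B : Finset ((Fin q → Fin n) → Bool))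
    (ε : ℝ) (hB : (B.card : ℝ) ≤ ε * (Fintype.card ((Fin q → Fin n) → Bool) : ℝ))
    (hP : ∀ A, A ∉ B → P (fun K => sg (A K))) : 1 - ε ≤ tprob n q P := by
  have hpos : (0:ℝ) < (Fintype.card ((Fin q → Fin n) → Bool) : ℝ) := by
    exact_mod_cast Fintype.card_pos
  rw [tprob, le_div_iff₀ hpos]
  have h1 : Fintype.card ((Fin q → Fin n) → Bool) - B.card ≤
      Nat.card {A : (Fin q → Fin n) → Bool // P (signT A)} := by
    rw [Nat.card_eq_fintype_card, Fintype.card_subtype, ← Finset.card_compl]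
    apply Finset.card_le_card
    intro A hA
    rw [Finset.mem_compl] at hA
    rw [Finset.mem_filter]
    exact ⟨Finset.mem_univ _, hP A hA⟩
  have h2 : Fintype.card ((Fin q → Fin n) → Bool) ≤
      Nat.card {A : (Fin q → Fin n) → Bool // P (signT A)} + B.card := by omega
  have h3 : (Fintype.card ((Fin q → Fin n) → Bool) : ℝ) ≤
      Nat.card {A : (Fin q → Fin n) → Bool // P (signT A)} + B.card := by exact_mod_cast h2
  linarith

lemma goodM_mono {n q : ℕ} {hqe : q % 2 = 0} {s t : ℝ} (hst : s ≤ t)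
    {A : (Fin q → Fin n) → ℝ} (h : goodM n q hqe t A) : goodM n q hqe s A := by
  obtain ⟨M, h1, h2, h3, h4, h5⟩ := h
  exact ⟨M, h1, h2, h3, h4, hst.trans h5⟩

/-- Regime where the target is at most one. -/
lemma regime_small (n q : ℕ) (hq2 : 2 ≤ q) (hqe : q % 2 = 0) (hn : 2 ≤ n) (t : ℝ) (ht : t ≤ 1) :
    1 - 1 / (n : ℝ) ≤ tprob n q (goodM n q hqe t) := by
  set C : Finset (Fin q → Fin n) := Finset.univ.image (fun j : Fin n => fun _ : Fin q => j)
    with hC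
  have hcard : C.card = n := by
    rw [hC, Finset.card_image_of_injective]
    · simp
    · intro a b hab
      exact congrFun hab ⟨0, by omega⟩
  have hnR : (0:ℝ) < n := by exact_mod_cast (show 0 < n by omega)
  have hh := hoeffding_count (fun K : Fin q → Fin n => if K ∈ C then (-1 : ℝ) else 0) n n
    (by
      have : ∀ K : Fin q → Fin n, (if K ∈ C then (-1 : ℝ) else 0) ^ 2 =
          if K ∈ C then 1 else 0 := by intro K; split_ifs <;> norm_num
      simp_rw [this]
      rw [Finset.sum_boole]
      simp [hcard]) hnR hnR.le
  refine tprob_ge _ _ (1 / (n:ℝ)) (hh.trans ?_) ?_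
  · gcongr
    refine le_trans (le_of_eq ?_) (exp_half_le n (by omega))
    congr 2
    field_simp
  · intro A hA
    apply goodM_mono ht
    by_cases hex : ∃ j : Fin n, A (fun _ => j) = true
    · obtain ⟨j, hj⟩ := hex
      exact goodM_of_diag hqe j A hj
    · exfalso
      push Not at hex
      apply hA
      rw [Finset.mem_filter]
      refine ⟨Finset.mem_univ _, ?_⟩
      have : ∀ K : Fin q → Fin n, (if K ∈ C then (-1 : ℝ) else 0) * sg (A K) =
          if K ∈ C then 1 else 0 := by
        intro K
        split_ifs with hK
        · rw [hC, Finset.mem_image] at hK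
          obtain ⟨j, -, rfl⟩ := hK
          have := hex j
          simp only [Bool.not_eq_true] at this
          rw [this]; simp [sg]
        · ring
      simp_rw [this]
      rw [Finset.sum_boole]
      simp [hcard]

open Classical in
lemma regime_main (n q : ℕ) (hq2 : 2 ≤ q) (hqe : q % 2 = 0) (hqn : 2 * q ≤ n) (t : ℝ)
    (ht : t ≤ (n.choose q : ℝ) / 2 / (lam n (q / 2) * n ^ (q / 2)) - 1) :
    1 - 10 / (n : ℝ) ≤ tprob n q (goodM n q hqe t) := by
  have hn0 : 0 < n := by omega
  have hnR : (0:ℝ) < n := by exact_mod_cast hn0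
  have hNn : n ≤ n.choose (q / 2) := le_choose_self n _ (by omega) (by omega)
  have hCn : n ≤ n.choose q := le_choose_self n _ (by omega) (by omega)
  have hCnR : (n:ℝ) ≤ n.choose q := by exact_mod_cast hCn
  have hNpos : 0 < n.choose (q / 2) := by omega
  set Ω := (Fintype.card ((Fin q → Fin n) → Bool) : ℝ) with hΩ
  -- event 1
  set B1 := Finset.univ.filter fun A : (Fin q → Fin n) → Bool => ¬ goodNet n (q / 2) q A with hB1
  have h1 : (B1.card : ℝ) ≤ 1 / n * Ω := by
    refine (badNet_count n (q / 2) q (by omega) hNpos).trans ?_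
    gcongr
    rw [one_div_pow]
    apply one_div_le_one_div_of_le hnR
    have := (Nat.lt_two_pow_self (n := n.choose (q / 2))).le
    exact_mod_cast hNn.trans this
  -- event 2
  have hf : (0:ℝ) < q.factorial := by positivity
  have hCpos : (0:ℝ) < n.choose q := lt_of_lt_of_le hnR hCnR
  set s2 : ℝ := q.factorial * (n.choose q) / 2 with hs2
  set B2 := Finset.univ.filter fun A : (Fin q → Fin n) → Bool =>
      ∑ p ∈ pairR n q, sg (A p.1) * sg (A p.2) ≤ -s2 with hB2
  have h2 : (B2.card : ℝ) ≤ 8 / n * Ω := by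
    refine (chaos_count (pairR n q) (fun p hp => (Finset.mem_filter.mp hp).2.1) s2
      (by positivity)).trans ?_
    have hc : ((pairR n q).card : ℝ) ≤ n.choose q * q.factorial * q.factorial := by
      exact_mod_cast card_pairR n q
    refine mul_le_mul_of_nonneg_right ?_ (Nat.cast_nonneg _)
    calc 2 * ((pairR n q).card : ℝ) / s2 ^ 2 ≤
        2 * ((n.choose q : ℝ) * q.factorial * q.factorial) / s2 ^ 2 := by gcongr
      _ = 8 / (n.choose q : ℝ) := by rw [hs2]; field_simp; norm_num
      _ ≤ 8 / (n : ℝ) := by gcongr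
  -- event 3
  set B3 := Finset.univ.filter fun A : (Fin q → Fin n) → Bool =>
      (n:ℝ) ^ (q / 2) ≤ ∑ K, (-(if oddS K = ∅ then 1 else 0) : ℝ) * sg (A K) with hB3
  have h3 : (B3.card : ℝ) ≤ 1 / n * Ω := by
    have hV : ∑ K : Fin q → Fin n, (-(if oddS K = ∅ then 1 else 0) : ℝ) ^ 2 ≤ n ^ (q - 1) := by
      have : ∀ K : Fin q → Fin n, (-(if oddS K = ∅ then 1 else 0) : ℝ) ^ 2 =
          if oddS K = ∅ then 1 else 0 := by intro K; split_ifs <;> norm_num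
      simp_rw [this]
      rw [Finset.sum_boole]
      obtain ⟨m, rfl⟩ : ∃ m, q = m + 1 := ⟨q - 1, by omega⟩
      exact_mod_cast even_count n m
    refine (hoeffding_count _ ((n:ℝ) ^ (q / 2)) _ hV (by positivity) (by positivity)).trans ?_
    gcongr
    refine le_trans (le_of_eq ?_) (exp_half_le n hn0)
    congr 2
    rw [← pow_mul, show q / 2 * 2 = (q - 1) + 1 by omega, pow_succ]
    field_simp
  refine tprob_ge _ (B1 ∪ B2 ∪ B3) (10 / (n:ℝ)) ?_ ?_
  · have hu : ((B1 ∪ B2 ∪ B3).card : ℝ) ≤ B1.card + B2.card + B3.card := by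
      exact_mod_cast (Finset.card_union_le _ _).trans
        (Nat.add_le_add_right (Finset.card_union_le _ _) _)
    have : 10 / (n:ℝ) * Ω = 1 / n * Ω + 8 / n * Ω + 1 / n * Ω := by ring
    linarith
  · intro A hA
    simp only [Finset.mem_union, not_or] at hA
    obtain ⟨⟨hA1, hA2⟩, hA3⟩ := hA
    have g1 : goodNet n (q / 2) q A := by
      by_contra hc
      exact hA1 (Finset.mem_filter.mpr ⟨Finset.mem_univ _, hc⟩)
    have g2 : -s2 < ∑ p ∈ pairR n q, sg (A p.1) * sg (A p.2) := by
      by_contra hc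
      exact hA2 (Finset.mem_filter.mpr ⟨Finset.mem_univ _, not_lt.mp hc⟩)
    have g3 : ∑ K, (-(if oddS K = ∅ then 1 else 0) : ℝ) * sg (A K) < (n:ℝ) ^ (q / 2) := by
      by_contra hc
      exact hA3 (Finset.mem_filter.mpr ⟨Finset.mem_univ _, not_lt.mp hc⟩)
    have hD : (n.choose q : ℝ) / 2 ≤ ∑ K, sg (A K) * bco (fun K => sg (A K)) (img K) := by
      rw [diag_value]
      have := mul_le_mul_of_nonneg_left g2.le (inv_nonneg.mpr hf.le)
      have e : (q.factorial : ℝ)⁻¹ * -s2 = - (n.choose q : ℝ) / 2 := by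
        rw [hs2]; field_simp
      rw [e] at this
      linarith
    have hE : -(n:ℝ) ^ (q / 2) ≤ ∑ K, sg (A K) * (if oddS K = ∅ then 1 else 0) := by
      have : ∑ K, (-(if oddS K = ∅ then 1 else 0) : ℝ) * sg (A K) =
          - ∑ K, sg (A K) * (if oddS K = ∅ then 1 else 0) := by
        rw [← Finset.sum_neg_distrib]
        exact Finset.sum_congr rfl (fun K _ => by ring)
      rw [this] at g3
      linarith
    refine goodM_mono (ht.trans (le_of_eq ?_)) (goodM_of_good hq2 hqe hn0 hNpos A g1 _ _ hD hE)
    rw [neg_div, div_self (by positivity)]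
    ring

lemma target_sq (n h : ℕ) :
    ((1 / 40 : ℝ) ^ (2 * h) * (n : ℝ) ^ (((2 * h : ℕ) : ℝ) / 4) /
      ((2 * h : ℕ) : ℝ) ^ (((2 * h : ℕ) : ℝ) / 4)) ^ 2 =
      (n : ℝ) ^ h / ((2560000 : ℝ) ^ h * ((2 * h : ℕ) : ℝ) ^ h) := by
  have hr : ∀ x : ℕ, ((x : ℝ) ^ (((2 * h : ℕ) : ℝ) / 4)) ^ 2 = (x : ℝ) ^ h := by
    intro x
    rw [← Real.rpow_natCast, ← Real.rpow_mul (by positivity), ← Real.rpow_natCast]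
    congr 1
    push_cast
    ring
  rw [div_pow, mul_pow, hr, hr, ← pow_mul, show 2 * h * 2 = 4 * h by ring, pow_mul]
  rw [show ((1 / 40 : ℝ)) ^ 4 = 1 / 2560000 by norm_num, one_div_pow]
  rw [one_div_mul_eq_div, div_div]

lemma main_numeric (n h : ℕ) (hh : 1 ≤ h) (hn : 2560000 * (2 * h) < n) :
    (1 / 40 : ℝ) ^ (2 * h) * (n : ℝ) ^ (((2 * h : ℕ) : ℝ) / 4) /
      ((2 * h : ℕ) : ℝ) ^ (((2 * h : ℕ) : ℝ) / 4) ≤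
    (n.choose (2 * h) : ℝ) / 2 / (lam n h * n ^ h) - 1 := by
  set T := (1 / 40 : ℝ) ^ (2 * h) * (n : ℝ) ^ (((2 * h : ℕ) : ℝ) / 4) /
      ((2 * h : ℕ) : ℝ) ^ (((2 * h : ℕ) : ℝ) / 4) with hT
  have hT0 : 0 ≤ T := by positivity
  have hTsq := target_sq n h
  rw [← hT] at hTsq
  set q : ℕ := 2 * h with hq
  have hn0 : 0 < n := by omega
  have hnR : (0:ℝ) < n := by exact_mod_cast hn0
  have hqR : (0:ℝ) < q := by exact_mod_cast (show 0 < q by omega)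
  have hnq : (2560000 : ℝ) * q ≤ n := by exact_mod_cast hn.le
  have hT1 : 1 ≤ T := by
    have : 1 ≤ T ^ 2 := by
      rw [hTsq, one_le_div (by positivity), ← mul_pow]
      exact pow_le_pow_left₀ (by positivity) hnq _
    nlinarith
  set N : ℝ := (n.choose h : ℝ) with hN
  set C : ℝ := (n.choose q : ℝ) with hC
  set f : ℝ := (h.factorial : ℝ) with hf
  have hfpos : 0 < f := by positivity
  have hNpos : 0 < N := by
    rw [hN]; exact_mod_cast Nat.choose_pos (show h ≤ n by omega)
  have hCpos : 0 < C := by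
    rw [hC]; exact_mod_cast Nat.choose_pos (show q ≤ n by omega)
  set X := C / 2 / (lam n h * n ^ h) with hX
  have hlam : 0 < lam n h := by rw [lam]; positivity
  have hX0 : 0 ≤ X := by positivity
  have hXsq : X ^ 2 = C ^ 2 * f ^ 2 / (1296 * N * n ^ (2 * h)) := by
    rw [hX, lam, ← hN, ← hf]
    have hs : √N ^ 2 = N := Real.sq_sqrt hNpos.le
    rw [div_pow, div_pow, mul_pow, div_pow, mul_pow, hs, ← pow_mul, mul_comm h 2]
    field_simp
    norm_num
  -- binomial estimates
  have e1 : N * f ≤ (n:ℝ) ^ h := by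
    have := Nat.choose_le_pow_div (α := ℝ) h n
    rwa [le_div_iff₀ hfpos] at this
  have e2 : (n:ℝ) ^ q ≤ 2 ^ q * (C * q.factorial) := by
    have h1 := Nat.pow_le_choose (α := ℝ) q n
    rw [div_le_iff₀ (by positivity)] at h1
    refine le_trans ?_ (mul_le_mul_of_nonneg_left h1 (by positivity))
    rw [← mul_pow]
    apply pow_le_pow_left₀ hnR.le
    have : n ≤ 2 * (n + 1 - q) := by omega
    exact_mod_cast this
  have e3 : (q.factorial : ℝ) ≤ 2 ^ q * (f * f) := by
    have h1 := Nat.choose_mul_factorial_mul_factorial (show h ≤ q by omega)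
    rw [show q - h = h by omega] at h1
    have h2 := Nat.choose_le_two_pow q h
    have h3 : q.factorial ≤ 2 ^ q * (h.factorial * h.factorial) := by
      rw [← h1, mul_assoc]
      exact Nat.mul_le_mul_right _ h2
    rw [hf]
    exact_mod_cast h3
  have e4 : f ≤ (q:ℝ) ^ h := by
    have h1 : h.factorial ≤ q ^ h :=
      (Nat.factorial_le_pow h).trans (Nat.pow_le_pow_left (by omega) h)
    rw [hf]
    exact_mod_cast h1
  have e5 : (n:ℝ) ^ q ≤ 4 ^ q * (C * (f * f)) := by
    refine e2.trans ?_
    calc (2:ℝ) ^ q * (C * q.factorial) ≤ 2 ^ q * (C * (2 ^ q * (f * f))) := by gcongr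
      _ = (2 * 2) ^ q * (C * (f * f)) := by rw [mul_pow]; ring
      _ = _ := by norm_num
  have e6 : ((n:ℝ) ^ q) ^ 2 ≤ 256 ^ h * (C ^ 2 * f ^ 4) := by
    calc ((n:ℝ) ^ q) ^ 2 ≤ (4 ^ q * (C * (f * f))) ^ 2 := by gcongr
      _ = ((4:ℝ) ^ 4) ^ h * (C ^ 2 * f ^ 4) := by
        rw [← pow_mul, mul_pow, ← pow_mul, show q * 2 = 4 * h by omega]; ring
      _ = _ := by norm_num
  have key : (2 * T) ^ 2 ≤ X ^ 2 := by
    rw [mul_pow, hTsq, hXsq, ← mul_div_assoc, div_le_div_iff₀ (by positivity) (by positivity)]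
    have hf2 : 0 < f ^ 2 := by positivity
    refine le_of_mul_le_mul_right ?_ hf2
    have h10 : (10000:ℝ) ≤ 10000 ^ h := by
      calc (10000:ℝ) = 10000 ^ 1 := by norm_num
        _ ≤ _ := pow_le_pow_right₀ (by norm_num) hh
    have hP : (2560000 : ℝ) ^ h = 256 ^ h * 10000 ^ h := by rw [← mul_pow]; norm_num
    calc 2 ^ 2 * (n:ℝ) ^ h * (1296 * N * n ^ (2 * h)) * f ^ 2
        = 5184 * n ^ h * n ^ (2 * h) * f * (N * f) := by ring
      _ ≤ 5184 * n ^ h * n ^ (2 * h) * (q:ℝ) ^ h * n ^ h := by gcongr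
      _ = 5184 * ((n:ℝ) ^ q) ^ 2 * q ^ h := by rw [hq]; ring
      _ ≤ 10000 ^ h * (256 ^ h * (C ^ 2 * f ^ 4)) * q ^ h := by
          gcongr
          linarith
      _ = C ^ 2 * f ^ 2 * (2560000 ^ h * (q:ℝ) ^ h) * f ^ 2 := by rw [hP]; ring
  have := abs_le_of_sq_le_sq' key hX0
  linarith [this.2]

lemma small_numeric (n h : ℕ) (hh : 1 ≤ h) (hn : n ≤ 2560000 * (2 * h)) :
    (1 / 40 : ℝ) ^ (2 * h) * (n : ℝ) ^ (((2 * h : ℕ) : ℝ) / 4) /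
      ((2 * h : ℕ) : ℝ) ^ (((2 * h : ℕ) : ℝ) / 4) ≤ 1 := by
  have hTsq := target_sq n h
  set T := (1 / 40 : ℝ) ^ (2 * h) * (n : ℝ) ^ (((2 * h : ℕ) : ℝ) / 4) /
      ((2 * h : ℕ) : ℝ) ^ (((2 * h : ℕ) : ℝ) / 4) with hT
  have hqR : (0:ℝ) < ((2 * h : ℕ) : ℝ) := by exact_mod_cast (show 0 < 2 * h by omega)
  have hnq : (n:ℝ) ≤ 2560000 * ((2 * h : ℕ) : ℝ) := by exact_mod_cast hn
  have : T ^ 2 ≤ 1 := by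
    rw [hTsq, div_le_one (by positivity), ← mul_pow]
    exact pow_le_pow_left₀ (by positivity) hnq _
  nlinarith

lemma rpow_half_ge (n : ℕ) (c : ℝ) (hc : 0 < c) (hn : c ^ 2 ≤ n) :
    c / (n:ℝ) ≤ (n:ℝ) ^ (-(1/2 : ℝ)) := by
  have hnR : (0:ℝ) < n := lt_of_lt_of_le (by positivity) hn
  rw [Real.rpow_neg hnR.le, ← Real.sqrt_eq_rpow]
  have h1 : c ≤ √(n:ℝ) := Real.le_sqrt_of_sq_le hn
  have h2 : √(n:ℝ) * √(n:ℝ) = n := Real.mul_self_sqrt hnR.le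
  have h3 : 0 < √(n:ℝ) := Real.sqrt_pos.mpr hnR
  rw [div_le_iff₀ hnR]
  have h4 : (√(n:ℝ))⁻¹ * n = √(n:ℝ) := by
    rw [inv_mul_eq_div, Real.div_sqrt]
  rw [h4]
  exact h1

theorem stmt_13 : ∃ c₁ c₂ : ℝ, 0 < c₁ ∧ c₁ < 1 ∧ 0 < c₂ ∧
    ∀ (n q : ℕ) (hq2 : 2 ≤ q) (hqe : q % 2 = 0) (hqn : q ≤ n),
      1 - (n : ℝ) ^ (-c₂) ≤
        tprob n q (fun A =>
          ∃ M : (Fin (q / 2) → Fin n) → (Fin (q / 2) → Fin n) → ℝ,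
            (∀ I J, M I J = M J I) ∧
            (∀ y : (Fin (q / 2) → Fin n) → ℝ,
              0 ≤ ∑ I, ∑ J, y I * M I J * y J) ∧
            (∀ I J K L : Fin (q / 2) → Fin n,
              (∀ v, cnt I v + cnt J v = cnt K v + cnt L v) → M I J = M K L) ∧
            (∑ I, M I I) = 1 ∧
            c₁ ^ q * (n : ℝ) ^ ((q : ℝ) / 4) / (q : ℝ) ^ ((q : ℝ) / 4) ≤
              ∑ I, ∑ J, A (tupConcat q hqe I J) * M I J) := by
  refine ⟨1 / 40, 1 / 2, by norm_num, by norm_num, by norm_num, ?_⟩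
  intro n q hq2 hqe hqn
  obtain ⟨h, rfl⟩ : ∃ h, q = 2 * h := ⟨q / 2, by omega⟩
  change 1 - (n : ℝ) ^ (-(1 / 2 : ℝ)) ≤ tprob n (2 * h) (goodM n (2 * h) hqe _)
  have hhalf : 2 * h / 2 = h := by omega
  by_cases hn : n ≤ 2560000 * (2 * h)
  · have h1 := regime_small n (2 * h) hq2 hqe (by omega) _ (small_numeric n h (by omega) hn)
    have h2 := rpow_half_ge n 1 (by norm_num) (by
      have : 1 ≤ n := by omega
      have : (1:ℝ) ≤ n := by exact_mod_cast this
      linarith)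
    linarith
  · push Not at hn
    have h1 := regime_main n (2 * h) hq2 hqe (by omega)
      ((1 / 40 : ℝ) ^ (2 * h) * (n:ℝ) ^ (((2 * h : ℕ) : ℝ) / 4) / ((2 * h : ℕ) : ℝ) ^ (((2 * h : ℕ) : ℝ) / 4)) (by
      rw [hhalf]
      exact main_numeric n h (by omega) hn)
    have h2 := rpow_half_ge n 10 (by norm_num) (by
      have : 100 ≤ n := by omega
      have : (100:ℝ) ≤ n := by exact_mod_cast this
      linarith)
    linarith
end

section
/- There exist absolute constants C, c > 0 such that for every even q with 2 ≤ q ≤ n, the following holds with probability at least 1 − n^{−c} over a random q-tensor A with i.i.d. entries uniform on {−1,+1}: the unique SoS-symmetric matrix representation F of f(x) = Σ_{K∈[n]^q} A_K x^K, given by F[I,J] = (Σ_{K∈O(α(I)+α(J))} A_K) / |O(α(I)+α(J))|, satisfies sup_{‖y‖₂=1} yᵀFy ≤ C^q · n^{q/4} / q^{q/4}; in particular, sup_{‖x‖₂=1} ⟨A, x^{⊗q}⟩ ≤ C^q · n^{q/4} / q^{q/4}. -/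
open scoped BigOperators

/-- The bilinear form associated with the SoS-symmetric representation. -/
noncomputable def QQ {n h : ℕ} (q : ℕ) (A : (Fin q → Fin n) → ℝ)
    (y z : (Fin h → Fin n) → ℝ) : ℝ :=
  ∑ I, ∑ J, y I *
    ((∑ K ∈ Oset n q (fun v => cnt I v + cnt J v), A K) /
      ((Oset n q (fun v => cnt I v + cnt J v)).card : ℝ)) * z J

lemma exists_net_s14 (E : Type*) [NormedAddCommGroup E] [NormedSpace ℝ E] [FiniteDimensional ℝ E] :
    ∃ T : Finset E, T.card ≤ 5 ^ Module.finrank ℝ E ∧ (∀ x ∈ T, ‖x‖ ≤ 2) ∧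
      ∀ u : E, ‖u‖ ≤ 2 → ∃ x ∈ T, ‖u - x‖ ≤ 1 := by
  classical
  let P : ℕ → Prop := fun k => ∃ T : Finset E, T.card = k ∧ (∀ x ∈ T, ‖x‖ ≤ 2) ∧
    ∀ c ∈ T, ∀ d ∈ T, c ≠ d → 1 ≤ ‖c - d‖
  have hb : ∀ k, P k → k ≤ 5 ^ Module.finrank ℝ E := by
    rintro k ⟨T, rfl, h1, h2⟩
    exact Besicovitch.card_le_of_separated T h1 h2
  have h0 : P 0 := ⟨∅, by simp⟩
  obtain ⟨T, hT, h1, h2⟩ := Nat.findGreatest_spec (P := P) (Nat.zero_le (5 ^ Module.finrank ℝ E)) h0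
  refine ⟨T, Besicovitch.card_le_of_separated T h1 h2, h1, fun u hu => ?_⟩
  by_contra! hcon
  have hu' : u ∉ T := fun hm => by
    have := hcon u hm
    simp at this
    linarith
  have hP : P (T.card + 1) := by
    refine ⟨insert u T, Finset.card_insert_of_notMem hu', ?_, ?_⟩
    · intro x hx
      rcases Finset.mem_insert.1 hx with rfl | hx
      · exact hu
      · exact h1 x hx
    · intro c hc d hd hcd
      rcases Finset.mem_insert.1 hc with hc1 | hc1 <;>
        rcases Finset.mem_insert.1 hd with hd1 | hd1
      · exact absurd (hc1.trans hd1.symm) hcd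
      · rw [hc1]; exact (hcon d hd1).le
      · rw [hd1, norm_sub_rev]; exact (hcon c hc1).le
      · exact h2 c hc1 d hd1 hcd
  have := Nat.le_findGreatest (hb _ hP) hP
  omega

lemma net_functional {E : Type*} [NormedAddCommGroup E] [NormedSpace ℝ E] [FiniteDimensional ℝ E]
    (T : Finset E) (hT : ∀ u : E, ‖u‖ ≤ 2 → ∃ x ∈ T, ‖u - x‖ ≤ 1)
    (L : E →ₗ[ℝ] ℝ) (t : ℝ) (ht : 0 ≤ t) (hL : ∀ x ∈ T, |L x| ≤ t) (v : E) : |L v| ≤ t * ‖v‖ := by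
  let L' := LinearMap.toContinuousLinearMap L
  have hL' : ∀ x, L' x = L x := fun x => rfl
  have key : ‖L'‖ ≤ (t + ‖L'‖) / 2 := by
    refine ContinuousLinearMap.opNorm_le_of_unit_norm (by positivity) ?_
    intro u hu
    obtain ⟨x, hx, hux⟩ := hT ((2 : ℝ) • u) (by rw [norm_smul, hu]; norm_num)
    have h1 : (2 : ℝ) * L' u = L' x + L' ((2 : ℝ) • u - x) := by
      rw [map_sub, map_smul]; simp
    have h2 : ‖L' ((2 : ℝ) • u - x)‖ ≤ ‖L'‖ * 1 := L'.le_opNorm_of_le hux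
    have h3 : ‖(2 : ℝ) * L' u‖ ≤ t + ‖L'‖ := by
      rw [h1]
      refine (norm_add_le _ _).trans ?_
      have := hL x hx
      rw [← hL', ← Real.norm_eq_abs] at this
      linarith
    rw [norm_mul] at h3
    norm_num at h3 ⊢
    linarith
  have h4 := L'.le_of_opNorm_le (c := t) (by linarith) v
  rwa [hL', Real.norm_eq_abs] at h4

lemma net_bilin {E : Type*} [NormedAddCommGroup E] [NormedSpace ℝ E] [FiniteDimensional ℝ E]
    (T : Finset E) (hT : ∀ u : E, ‖u‖ ≤ 2 → ∃ x ∈ T, ‖u - x‖ ≤ 1)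
    (b : E →ₗ[ℝ] E →ₗ[ℝ] ℝ) (t : ℝ) (ht : 0 ≤ t) (hb : ∀ x ∈ T, ∀ y ∈ T, |b x y| ≤ t) (u v : E) :
    |b u v| ≤ t * ‖v‖ * ‖u‖ :=
  net_functional T hT (b.flip v) (t * ‖v‖) (by positivity)
    (fun x hx => net_functional T hT (b x) t ht (hb x hx) v) u

lemma chernoff {ι : Type*} [Fintype ι] [DecidableEq ι] (w : ι → ℝ) (V t l : ℝ) (hl : 0 ≤ l)
    (hw : ∑ i, w i ^ 2 ≤ V) :
    ((Finset.univ.filter fun A : ι → Bool => t ≤ ∑ i, (if A i then (1 : ℝ) else -1) * w i).card : ℝ)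
      ≤ Fintype.card (ι → Bool) * Real.exp (l ^ 2 * V / 2 - l * t) := by
  have hmgf : ∑ A : ι → Bool, Real.exp (l * ∑ i, (if A i then (1 : ℝ) else -1) * w i)
      ≤ Fintype.card (ι → Bool) * Real.exp (l ^ 2 * V / 2) := by
    have h1 : ∀ A : ι → Bool, Real.exp (l * ∑ i, (if A i then (1 : ℝ) else -1) * w i)
        = ∏ i, Real.exp (l * ((if A i then (1 : ℝ) else -1) * w i)) := by
      intro A
      rw [Finset.mul_sum, Real.exp_sum]
    simp_rw [h1]
    rw [← Fintype.prod_sum (fun i (a : Bool) => Real.exp (l * ((if a then (1 : ℝ) else -1) * w i)))]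
    calc ∏ i, ∑ a : Bool, Real.exp (l * ((if a then (1 : ℝ) else -1) * w i))
        ≤ ∏ i, (2 * Real.exp ((l * w i) ^ 2 / 2)) := by
          refine Finset.prod_le_prod (fun i _ => by positivity) (fun i _ => ?_)
          have := Real.cosh_le_exp_half_sq (l * w i)
          rw [Real.cosh_eq] at this
          simp only [Fintype.sum_bool, if_true, one_mul, Bool.false_eq_true, if_false, neg_mul,
            mul_neg]
          linarith
      _ = 2 ^ Fintype.card ι * Real.exp (l ^ 2 * (∑ i, w i ^ 2) / 2) := by
          rw [Finset.prod_mul_distrib, ← Real.exp_sum]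
          simp [mul_pow, Finset.mul_sum, Finset.sum_div]
      _ ≤ _ := by
          simp only [Fintype.card_fun, Fintype.card_bool, Nat.cast_pow, Nat.cast_ofNat]
          gcongr
  rw [Real.exp_sub, ← mul_div_assoc, le_div_iff₀ (Real.exp_pos _)]
  refine le_trans ?_ hmgf
  rw [← nsmul_eq_mul, ← Finset.sum_const]
  refine le_trans ?_ (Finset.sum_le_sum_of_subset_of_nonneg (Finset.filter_subset
    (fun A : ι → Bool => t ≤ ∑ i, (if A i then (1 : ℝ) else -1) * w i) _)
    (fun _ _ _ => (Real.exp_pos _).le))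
  refine Finset.sum_le_sum fun A hA => ?_
  have := (Finset.mem_filter.1 hA).2
  gcongr

lemma cnt_append {n h : ℕ} (I J : Fin h → Fin n) (v : Fin n) :
    cnt (Fin.append I J) v = cnt I v + cnt J v := by
  simp only [cnt, Finset.card_filter, Fin.sum_univ_add, Fin.append_left, Fin.append_right]

lemma mem_Oset {n q : ℕ} (K : Fin q → Fin n) (d : Fin n → ℕ) : K ∈ Oset n q d ↔ cnt K = d := by
  simp [Oset, funext_iff]

/-- The averaging kernel. -/
noncomputable def avK {n q : ℕ} (K K' : Fin q → Fin n) : ℝ :=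
  if cnt K = cnt K' then ((Oset n q (cnt K')).card : ℝ)⁻¹ else 0

lemma avK_symm {n q : ℕ} (K K' : Fin q → Fin n) : avK K K' = avK K' K := by
  unfold avK
  by_cases h : cnt K = cnt K'
  · simp [h]
  · simp [h, Ne.symm h]

lemma avK_sum {n q : ℕ} (K' : Fin q → Fin n) : ∑ K, avK K K' = 1 := by
  have hne : ((Oset n q (cnt K')).card : ℝ) ≠ 0 := by
    have : K' ∈ Oset n q (cnt K') := (mem_Oset _ _).2 rfl
    exact_mod_cast (Finset.card_pos.2 ⟨_, this⟩).ne'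
  have : (Oset n q (cnt K')) = Finset.univ.filter fun K => cnt K = cnt K' := by
    ext K; simp [mem_Oset]
  unfold avK
  rw [← Finset.sum_filter, ← this, Finset.sum_const, nsmul_eq_mul, mul_inv_cancel₀ hne]

/-- The coefficients of the bilinear form as a linear form in `A`. -/
noncomputable def wK {n q : ℕ} (z : (Fin q → Fin n) → ℝ) (K : Fin q → Fin n) : ℝ :=
  ∑ K', avK K K' * z K'

lemma wK_sq {n q : ℕ} (z : (Fin q → Fin n) → ℝ) : ∑ K, wK z K ^ 2 ≤ ∑ K, z K ^ 2 := by
  have h1 : ∀ K, wK z K ^ 2 ≤ ∑ K', avK K K' * z K' ^ 2 := by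
    intro K
    have hnn : ∀ K', 0 ≤ avK K K' := fun K' => by unfold avK; split_ifs <;> positivity
    have := Finset.sum_sq_le_sum_mul_sum_of_sq_le_mul Finset.univ
      (r := fun K' => avK K K' * z K') (f := fun K' => avK K K')
      (g := fun K' => avK K K' * z K' ^ 2) (fun i _ => hnn i)
      (fun i _ => mul_nonneg (hnn i) (sq_nonneg _)) (fun i _ => le_of_eq (by ring))
    simp_rw [avK_symm K] at this ⊢
    rw [avK_sum, one_mul] at this
    simpa only [wK, avK_symm K] using this
  refine (Finset.sum_le_sum fun K _ => h1 K).trans ?_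
  rw [Finset.sum_comm]
  simp_rw [← Finset.sum_mul, avK_sum, one_mul]
  exact le_rfl

/-- Tensor product of two vectors. -/
noncomputable def tens {n h : ℕ} (y z : (Fin h → Fin n) → ℝ) (K : Fin (h + h) → Fin n) : ℝ :=
  y (fun i => K (Fin.castAdd h i)) * z (fun i => K (Fin.natAdd h i))

lemma sum_append {n h : ℕ} (g : (Fin (h + h) → Fin n) → ℝ) :
    ∑ K, g K = ∑ I : Fin h → Fin n, ∑ J : Fin h → Fin n, g (Fin.append I J) := by
  rw [← Fintype.sum_prod_type', ← (Fin.appendEquiv h h).sum_comp]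
  rfl

lemma tens_append {n h : ℕ} (y z : (Fin h → Fin n) → ℝ) (I J : Fin h → Fin n) :
    tens y z (Fin.append I J) = y I * z J := by
  simp only [tens, Fin.append_left, Fin.append_right]

lemma tens_sq {n h : ℕ} (y z : (Fin h → Fin n) → ℝ) :
    ∑ K, tens y z K ^ 2 = (∑ I, y I ^ 2) * ∑ J, z J ^ 2 := by
  rw [sum_append, Finset.sum_mul_sum]
  simp_rw [tens_append, mul_pow]

lemma QQ_eq {n h : ℕ} (A : (Fin (h + h) → Fin n) → ℝ) (y z : (Fin h → Fin n) → ℝ) :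
    QQ (h + h) A y z = ∑ K, A K * wK (tens y z) K := by
  have h1 : ∑ K, A K * wK (tens y z) K = ∑ K', (∑ K, A K * avK K K') * tens y z K' := by
    simp_rw [wK, Finset.mul_sum, Finset.sum_mul]
    rw [Finset.sum_comm]
    simp_rw [mul_assoc]
  rw [h1, sum_append]
  unfold QQ
  refine Finset.sum_congr rfl fun I _ => Finset.sum_congr rfl fun J _ => ?_
  rw [tens_append]
  have h2 : (fun v => cnt I v + cnt J v) = cnt (Fin.append I J) := by
    ext v; rw [cnt_append]
  rw [h2]
  have h3 : (Oset n (h + h) (cnt (Fin.append I J))) =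
      Finset.univ.filter fun K => cnt K = cnt (Fin.append I J) := by
    ext K; simp [mem_Oset]
  have h4 : ∑ K, A K * avK K (Fin.append I J) =
      (∑ K ∈ Oset n (h + h) (cnt (Fin.append I J)), A K) /
        ((Oset n (h + h) (cnt (Fin.append I J))).card : ℝ) := by
    rw [Finset.sum_div]
    conv_rhs => rw [h3, Finset.sum_filter]
    refine Finset.sum_congr rfl fun K _ => ?_
    unfold avK
    rw [← h3]
    split_ifs <;> simp [div_eq_mul_inv]
  rw [h4]; ring

/-- The bilinear form `QQ` bundled. -/
noncomputable def QB {n h : ℕ} (q : ℕ) (A : (Fin q → Fin n) → ℝ) :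
    EuclideanSpace ℝ (Fin h → Fin n) →ₗ[ℝ] EuclideanSpace ℝ (Fin h → Fin n) →ₗ[ℝ] ℝ :=
  LinearMap.mk₂ ℝ (fun y z => QQ q A y z)
    (by intro a b c; simp [QQ, add_mul, Finset.sum_add_distrib])
    (by intro a b c; simp [QQ, Finset.mul_sum, mul_assoc])
    (by intro a b c; simp [QQ, mul_add, Finset.sum_add_distrib])
    (by
      intro a b c
      simp only [QQ, PiLp.smul_apply, smul_eq_mul, Finset.mul_sum]
      refine Finset.sum_congr rfl fun I _ => Finset.sum_congr rfl fun J _ => by ring)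

lemma QB_symm {n h : ℕ} (q : ℕ) (A : (Fin q → Fin n) → ℝ)
    (y z : EuclideanSpace ℝ (Fin h → Fin n)) : QB q A y z = QB q A z y := by
  simp only [QB, LinearMap.mk₂_apply, QQ]
  rw [Finset.sum_comm]
  refine Finset.sum_congr rfl fun I _ => Finset.sum_congr rfl fun J _ => ?_
  simp_rw [add_comm (cnt I _)]
  ring

/-- The multiset of a tuple. -/
def symOf {n h : ℕ} (I : Fin h → Fin n) : Sym (Fin n) h :=
  ⟨Multiset.map I Finset.univ.val, by simp⟩

lemma symOf_count {n h : ℕ} (I : Fin h → Fin n) (v : Fin n) :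
    Multiset.count v (symOf I : Multiset (Fin n)) = cnt I v := by
  simp only [symOf, Sym.coe_mk, cnt, Multiset.count_map, Finset.card_def, Finset.filter_val]
  simp_rw [eq_comm]

/-- Pullback of functions on multisets to symmetric tensors. -/
noncomputable def pull (n h : ℕ) :
    (Sym (Fin n) h → ℝ) →ₗ[ℝ] EuclideanSpace ℝ (Fin h → Fin n) where
  toFun z := WithLp.toLp 2 fun I => z (symOf I)
  map_add' a b := by ext; simp
  map_smul' a b := by ext; simp

lemma finrank_pull (n h : ℕ) :
    Module.finrank ℝ (LinearMap.range (pull n h)) ≤ (n + h - 1).choose h := by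
  refine (LinearMap.finrank_range_le _).trans ?_
  rw [Module.finrank_fintype_fun_eq_card, Sym.card_sym_eq_choose, Fintype.card_fin]

lemma QB_orth {n h : ℕ} (q : ℕ) (A : (Fin q → Fin n) → ℝ)
    (y r : EuclideanSpace ℝ (Fin h → Fin n)) (hr : r ∈ (LinearMap.range (pull n h))ᗮ) :
    QB q A y r = 0 := by
  simp only [QB, LinearMap.mk₂_apply, QQ]
  refine Finset.sum_eq_zero fun I _ => ?_
  have := (Submodule.mem_orthogonal _ _).1 hr _ (LinearMap.mem_range_self (pull n h)
    (fun s => (∑ K ∈ Oset n q (fun v => cnt I v + Multiset.count v (s : Multiset (Fin n))), A K) /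
      ((Oset n q (fun v => cnt I v + Multiset.count v (s : Multiset (Fin n)))).card : ℝ)))
  simp only [pull, LinearMap.coe_mk, AddHom.coe_mk, PiLp.inner_apply, symOf_count] at this
  simp_rw [mul_assoc]
  rw [← Finset.mul_sum]
  simp only [RCLike.inner_apply, conj_trivial] at this
  simp_rw [mul_comm (_ / _) (r _)]
  rw [this, mul_zero]

lemma QB_proj {n h : ℕ} (q : ℕ) (A : (Fin q → Fin n) → ℝ)
    (y : EuclideanSpace ℝ (Fin h → Fin n)) :
    QB q A y y = QB q A ((LinearMap.range (pull n h)).starProjection y)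
      ((LinearMap.range (pull n h)).starProjection y) := by
  set P := (LinearMap.range (pull n h)).starProjection y with hP
  have hr : y - P ∈ (LinearMap.range (pull n h))ᗮ := Submodule.sub_starProjection_mem_orthogonal y
  have h1 := QB_orth q A y _ hr
  have h2 := QB_orth q A P _ hr
  rw [map_sub] at h1 h2
  rw [QB_symm q A P y] at h2
  linarith

lemma choose_bound (n h q : ℕ) (hh : 1 ≤ h) (hq : q = h + h) (hn : q ≤ n) :
    16 * Real.sqrt ((n + h - 1).choose h) ≤
      (12 : ℝ) ^ q * (n : ℝ) ^ ((q : ℝ) / 4) / (q : ℝ) ^ ((q : ℝ) / 4) := by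
  have hh0 : (0 : ℝ) < h := by exact_mod_cast hh
  have hq0 : (0 : ℝ) < q := by rw [hq]; push_cast; linarith
  have hqh : (q : ℝ) = 2 * h := by rw [hq]; push_cast; ring
  have hnq : (q : ℝ) ≤ n := by exact_mod_cast hn
  have h1 : ((n + h - 1).choose h : ℝ) ≤ (9 * (n / q)) ^ h := by
    have ha : ((n + h - 1).choose h : ℝ) ≤ (3 / 2 * n : ℝ) ^ h / h.factorial := by
      refine (Nat.choose_le_pow_div h (n + h - 1)).trans ?_
      gcongr
      have : ((n + h - 1 : ℕ) : ℝ) ≤ n + h := by exact_mod_cast Nat.sub_le _ _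
      linarith
    have hb : ((h : ℝ) ^ h) / h.factorial ≤ 3 ^ h := by
      refine (Real.pow_div_factorial_le_exp (h : ℝ) hh0.le h).trans ?_
      rw [show Real.exp (h : ℝ) = Real.exp 1 ^ h by rw [← Real.exp_nat_mul, mul_one]]
      gcongr
      exact Real.exp_one_lt_three.le
    calc _ ≤ _ := ha
      _ = (3 / 2 * n / h : ℝ) ^ h * (((h : ℝ) ^ h) / h.factorial) := by
        rw [div_pow]; field_simp
      _ ≤ (3 / 2 * n / h : ℝ) ^ h * 3 ^ h := by gcongr
      _ = _ := by rw [← mul_pow, hqh]; congr 1; field_simp; ring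
  have h2 : Real.sqrt ((n + h - 1).choose h) ≤ 3 ^ h * ((n / q : ℝ) ^ ((q : ℝ) / 4)) := by
    rw [Real.sqrt_le_left (by positivity)]
    refine h1.trans (le_of_eq ?_)
    have hx : (0 : ℝ) ≤ n / q := by positivity
    have e1 : ((n / q : ℝ) ^ ((q : ℝ) / 4)) ^ 2 = (n / q : ℝ) ^ h := by
      rw [← Real.rpow_natCast (_ ^ _) 2, ← Real.rpow_mul hx, ← Real.rpow_natCast _ h]
      congr 1
      rw [hqh]; push_cast; ring
    rw [mul_pow, mul_pow, e1, ← pow_mul, mul_comm h 2, pow_mul]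
    norm_num
  rw [mul_div_assoc, ← Real.div_rpow (by positivity) (by positivity)]
  have h3 : (16 : ℝ) * 3 ^ h ≤ 12 ^ q := by
    have : (12 : ℝ) ^ q = 48 ^ h * 3 ^ h := by
      rw [hq, ← two_mul, pow_mul, ← mul_pow]; norm_num
    rw [this]
    gcongr
    calc (16 : ℝ) ≤ 48 ^ 1 := by norm_num
      _ ≤ _ := pow_le_pow_right₀ (by norm_num) hh
  calc _ ≤ 16 * (3 ^ h * ((n / q : ℝ) ^ ((q : ℝ) / 4))) := by gcongr
    _ = (16 * 3 ^ h) * ((n / q : ℝ) ^ ((q : ℝ) / 4)) := by ring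
    _ ≤ _ := by gcongr

lemma prod_cnt {n q : ℕ} (x : Fin n → ℝ) (K : Fin q → Fin n) :
    ∏ l, x (K l) = ∏ v, x v ^ cnt K v := by
  rw [← Finset.prod_fiberwise Finset.univ K (fun l => x (K l))]
  refine Finset.prod_congr rfl fun v _ => ?_
  rw [cnt, ← Finset.prod_const]
  refine Finset.prod_congr rfl fun l hl => ?_
  rw [(Finset.mem_filter.1 hl).2]

lemma poly_eq {n h : ℕ} (A : (Fin (h + h) → Fin n) → ℝ) (x : Fin n → ℝ) :
    ∑ K, A K * ∏ l, x (K l) =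
      QQ (h + h) A (fun I => ∏ l, x (I l)) (fun I : Fin h → Fin n => ∏ l, x (I l)) := by
  rw [QQ_eq]
  refine Finset.sum_congr rfl fun K _ => ?_
  congr 1
  have h1 : ∀ K' : Fin (h + h) → Fin n, tens (fun I => ∏ l, x (I l))
      (fun I : Fin h → Fin n => ∏ l, x (I l)) K' = ∏ l, x (K' l) := by
    intro K'
    rw [tens, Fin.prod_univ_add]
  unfold wK
  simp_rw [h1]
  have h2 : ∀ K', avK K K' * ∏ l, x (K' l) = avK K K' * ∏ l, x (K l) := by
    intro K'
    by_cases hc : cnt K = cnt K'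
    · rw [prod_cnt, prod_cnt, hc]
    · simp [avK, hc]
  simp_rw [h2]
  rw [← Finset.sum_mul]
  simp_rw [avK_symm K]
  rw [avK_sum, one_mul]

lemma tens_norm {n h : ℕ} (x : EuclideanSpace ℝ (Fin n)) (hx : ‖x‖ = 1) :
    ‖(WithLp.toLp 2 fun I : Fin h → Fin n => ∏ l, x (I l) :
      EuclideanSpace ℝ (Fin h → Fin n))‖ = 1 := by
  have h1 : ∑ i, x i ^ 2 = 1 := by
    rw [← EuclideanSpace.real_norm_sq_eq, hx, one_pow]
  rw [← pow_left_inj₀ (norm_nonneg _) zero_le_one two_ne_zero, EuclideanSpace.real_norm_sq_eq]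
  simp only [← Finset.prod_pow]
  rw [← Fintype.prod_sum (fun (_ : Fin h) i => x i ^ 2)]
  simp [h1]

lemma sum_sq_le_four {ι : Type*} [Fintype ι] (y : EuclideanSpace ℝ ι) (hy : ‖y‖ ≤ 2) :
    ∑ i, y i ^ 2 ≤ 4 := by
  rw [← EuclideanSpace.real_norm_sq_eq]
  nlinarith [norm_nonneg y]

lemma tail_bound (n h : ℕ) (y z : EuclideanSpace ℝ (Fin h → Fin n)) (hy : ‖y‖ ≤ 2)
    (hz : ‖z‖ ≤ 2) (N : ℝ) (hN : 0 ≤ N) :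
    ((Finset.univ.filter fun A : (Fin (h + h) → Fin n) → Bool =>
      16 * Real.sqrt N < |QQ (h + h) (signT A) y z|).card : ℝ) ≤
      Fintype.card ((Fin (h + h) → Fin n) → Bool) * (2 * Real.exp (-8 * N)) := by
  classical
  set w := wK (tens y z) with hw
  have hsq : ∑ K, w K ^ 2 ≤ 16 := by
    refine (wK_sq _).trans ?_
    rw [tens_sq]
    have h1 := sum_sq_le_four y hy
    have h2 := sum_sq_le_four z hz
    have h3 : 0 ≤ ∑ i, z i ^ 2 := Finset.sum_nonneg fun _ _ => sq_nonneg _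
    nlinarith
  have hs : Real.sqrt N ^ 2 = N := Real.sq_sqrt hN
  have c1 := chernoff w 16 (16 * Real.sqrt N) (Real.sqrt N) (Real.sqrt_nonneg _) hsq
  have c2 := chernoff (fun K => - w K) 16 (16 * Real.sqrt N) (Real.sqrt N) (Real.sqrt_nonneg _)
    (by simpa using hsq)
  have he : Real.sqrt N ^ 2 * 16 / 2 - Real.sqrt N * (16 * Real.sqrt N) = -8 * N := by
    linear_combination (-8) * hs
  rw [he] at c1 c2
  have hsub : (Finset.univ.filter fun A : (Fin (h + h) → Fin n) → Bool =>
      16 * Real.sqrt N < |QQ (h + h) (signT A) y z|) ⊆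
      (Finset.univ.filter fun A : (Fin (h + h) → Fin n) → Bool =>
        16 * Real.sqrt N ≤ ∑ i, (if A i then (1 : ℝ) else -1) * w i) ∪
      (Finset.univ.filter fun A : (Fin (h + h) → Fin n) → Bool =>
        16 * Real.sqrt N ≤ ∑ i, (if A i then (1 : ℝ) else -1) * (- w i)) := by
    intro A hA
    have hA' := (Finset.mem_filter.1 hA).2
    rw [QQ_eq] at hA'
    simp only [Finset.mem_union, Finset.mem_filter, Finset.mem_univ, true_and, mul_neg,
      Finset.sum_neg_distrib]
    rcases lt_abs.1 hA' with h1 | h1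
    · exact Or.inl h1.le
    · exact Or.inr h1.le
  have hc := (Finset.card_le_card hsub).trans (Finset.card_union_le _ _)
  have hc' := (Nat.cast_le (α := ℝ)).2 hc
  push_cast at hc'
  linarith

lemma le_choose (n h : ℕ) (hh : 1 ≤ h) : n ≤ (n + h - 1).choose h := by
  have h1 := Fintype.card_le_of_injective (fun i : Fin n => Sym.replicate h i)
    (Sym.replicate_right_injective (by omega))
  rwa [Sym.card_sym_eq_choose, Fintype.card_fin] at h1

lemma core (n h q : ℕ) (hh : 1 ≤ h) (hq : q = h + h) (hn : q ≤ n) :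
    1 - (n : ℝ) ^ (-1 : ℝ) ≤
      tprob n q (fun A =>
        (∀ y : EuclideanSpace ℝ (Fin h → Fin n), ‖y‖ = 1 →
          QQ q A y y ≤ (12 : ℝ) ^ q * (n : ℝ) ^ ((q : ℝ) / 4) / (q : ℝ) ^ ((q : ℝ) / 4)) ∧
        (∀ x : EuclideanSpace ℝ (Fin n), ‖x‖ = 1 →
          ∑ K : Fin q → Fin n, A K * ∏ l, x (K l) ≤
            (12 : ℝ) ^ q * (n : ℝ) ^ ((q : ℝ) / 4) / (q : ℝ) ^ ((q : ℝ) / 4))) := by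
  classical
  have hbd := choose_bound n h q hh hq hn
  have hnN := le_choose n h hh
  set R := (12 : ℝ) ^ q * (n : ℝ) ^ ((q : ℝ) / 4) / (q : ℝ) ^ ((q : ℝ) / 4) with hR
  clear_value R
  have hfr := finrank_pull n h
  set N := (n + h - 1).choose h with hN
  clear_value N
  subst hq
  obtain ⟨T, hTc, hT2, hTn⟩ := exists_net_s14 (LinearMap.range (pull n h))
  have hn0 : (0 : ℝ) < n := by
    have : 0 < n := by omega
    exact_mod_cast this
  have hN1 : (1 : ℝ) ≤ N := by
    have : 1 ≤ N := by omega
    exact_mod_cast this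
  -- deterministic part
  have det : ∀ A : (Fin (h + h) → Fin n) → ℝ,
      (∀ x ∈ T, ∀ y ∈ T, |QQ (h + h) A (x : EuclideanSpace ℝ (Fin h → Fin n))
        (y : EuclideanSpace ℝ (Fin h → Fin n))| ≤ 16 * Real.sqrt N) →
      ∀ y : EuclideanSpace ℝ (Fin h → Fin n), ‖y‖ = 1 → QQ (h + h) A y y ≤ R := by
    intro A hA y hy
    have h1 := QB_proj (h + h) A y
    have h2 := net_bilin T hTn ((QB (h + h) A).compl₁₂ (LinearMap.range (pull n h)).subtype
      (LinearMap.range (pull n h)).subtype) (16 * Real.sqrt N) (by positivity) hA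
      ((LinearMap.range (pull n h)).orthogonalProjectionOnto y)
      ((LinearMap.range (pull n h)).orthogonalProjectionOnto y)
    have h3 : ‖(LinearMap.range (pull n h)).orthogonalProjectionOnto y‖ ≤ 1 := by
      have := (LinearMap.range (pull n h)).norm_orthogonalProjectionOnto_apply_le y
      rwa [hy] at this
    have h4 : QQ (h + h) A y y = QB (h + h) A y y := rfl
    rw [h4, h1]
    refine le_trans (le_abs_self _) (le_trans h2 (le_trans ?_ hbd))
    have h5 : (0 : ℝ) ≤ 16 * Real.sqrt N := by positivity
    have h6 := norm_nonneg ((LinearMap.range (pull n h)).orthogonalProjectionOnto y)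
    calc _ ≤ 16 * Real.sqrt N * 1 * 1 := by gcongr
      _ = _ := by ring
  set P : ((Fin (h + h) → Fin n) → ℝ) → Prop := (fun A =>
        (∀ y : EuclideanSpace ℝ (Fin h → Fin n), ‖y‖ = 1 → QQ (h + h) A y y ≤ R) ∧
        (∀ x : EuclideanSpace ℝ (Fin n), ‖x‖ = 1 →
          ∑ K : Fin (h + h) → Fin n, A K * ∏ l, x (K l) ≤ R)) with hP
  have det2 : ∀ A : (Fin (h + h) → Fin n) → ℝ, ¬ P A →
      ∃ x ∈ T, ∃ y ∈ T, 16 * Real.sqrt N < |QQ (h + h) A (x : EuclideanSpace ℝ (Fin h → Fin n))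
        (y : EuclideanSpace ℝ (Fin h → Fin n))| := by
    intro A hA
    by_contra! hcon
    have hd := det A hcon
    refine hA ⟨hd, fun x hx => ?_⟩
    have h9 := hd (WithLp.toLp 2 fun I : Fin h → Fin n => ∏ l, x (I l)) (tens_norm x hx)
    have h10 := poly_eq A (fun i => x i)
    rw [h10]
    exact h9
  -- counting
  set Z : ℝ := ((Fintype.card ((Fin (h + h) → Fin n) → Bool) : ℕ) : ℝ) with hZ
  have hZ0 : 0 < Z := by rw [hZ]; exact_mod_cast Fintype.card_pos
  have hbad : ((Finset.univ.filter fun A : (Fin (h + h) → Fin n) → Bool => ¬ P (signT A)).card : ℝ)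
      ≤ Z * (n : ℝ)⁻¹ := by
    have hsub : (Finset.univ.filter fun A : (Fin (h + h) → Fin n) → Bool => ¬ P (signT A)) ⊆
        (T ×ˢ T).biUnion fun p => Finset.univ.filter fun A : (Fin (h + h) → Fin n) → Bool =>
          16 * Real.sqrt N < |QQ (h + h) (signT A) (p.1 : EuclideanSpace ℝ (Fin h → Fin n))
            (p.2 : EuclideanSpace ℝ (Fin h → Fin n))| := by
      intro A hA
      obtain ⟨x, hx, y, hy, hxy⟩ := det2 _ (Finset.mem_filter.1 hA).2
      exact Finset.mem_biUnion.2 ⟨(x, y), Finset.mem_product.2 ⟨hx, hy⟩,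
        Finset.mem_filter.2 ⟨Finset.mem_univ _, hxy⟩⟩
    have hc := (Finset.card_le_card hsub).trans Finset.card_biUnion_le
    have hc1 : ((Finset.univ.filter fun A : (Fin (h + h) → Fin n) → Bool =>
        ¬ P (signT A)).card : ℝ) ≤ ∑ p ∈ T ×ˢ T, Z * (2 * Real.exp (-8 * N)) := by
      refine le_trans ((Nat.cast_le (α := ℝ)).2 hc) ?_
      push_cast
      refine Finset.sum_le_sum fun p hp => ?_
      exact tail_bound n h p.1 p.2 (hT2 _ (Finset.mem_product.1 hp).1)
        (hT2 _ (Finset.mem_product.1 hp).2) N (by positivity)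
    refine hc1.trans ?_
    rw [Finset.sum_const, Finset.card_product, nsmul_eq_mul]
    have hT5 : (T.card : ℝ) ≤ 5 ^ N := by
      have : T.card ≤ 5 ^ N := hTc.trans (Nat.pow_le_pow_right (by norm_num) hfr)
      exact_mod_cast this
    have e1 : (2 : ℝ) ≤ Real.exp N := by
      have := Real.add_one_le_exp (N : ℝ)
      linarith
    have e2 : (5 : ℝ) ^ N ≤ Real.exp N ^ 2 := by
      rw [← Real.exp_nat_mul, show ((2 : ℕ) : ℝ) * (N : ℝ) = N * (2 : ℝ) by push_cast; ring,
        Real.exp_nat_mul]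
      gcongr
      have := Real.exp_one_gt_d9
      have h7 : Real.exp 2 = Real.exp 1 * Real.exp 1 := by rw [← Real.exp_add]; norm_num
      rw [h7]; nlinarith
    have e3 : (n : ℝ) ≤ Real.exp N := by
      have := Real.add_one_le_exp (N : ℝ)
      have h8 : (n : ℝ) ≤ N := by exact_mod_cast hnN
      linarith
    have e4 : Real.exp (-8 * N) = (Real.exp N ^ 8)⁻¹ := by
      rw [← Real.exp_nat_mul, ← Real.exp_neg]; congr 1; push_cast; ring
    push_cast
    rw [e4]
    set X := Real.exp (N : ℝ) with hX
    have hX0 : 0 < X := Real.exp_pos _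
    calc (T.card : ℝ) * T.card * (Z * (2 * (X ^ 8)⁻¹))
        ≤ X ^ 2 * X ^ 2 * (Z * (X * (X ^ 8)⁻¹)) := by
          gcongr
          · exact hT5.trans e2
          · exact hT5.trans e2
      _ = Z * (X ^ 3)⁻¹ := by field_simp
      _ ≤ Z * X⁻¹ := by
          gcongr
          nlinarith [mul_pos hX0 hX0, mul_self_nonneg (X - 1), sq_nonneg X]
      _ ≤ Z * (n : ℝ)⁻¹ := by gcongr
  have hsplit := Finset.card_filter_add_card_filter_not (s := Finset.univ)
    (fun A : (Fin (h + h) → Fin n) → Bool => P (signT A))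
  have hsplit' : ((Finset.univ.filter fun A : (Fin (h + h) → Fin n) → Bool =>
      P (signT A)).card : ℝ) + ((Finset.univ.filter fun A : (Fin (h + h) → Fin n) → Bool =>
      ¬ P (signT A)).card : ℝ) = Z := by
    rw [hZ, ← Finset.card_univ]
    exact_mod_cast hsplit
  unfold tprob
  rw [Nat.card_eq_fintype_card, Fintype.card_subtype, Real.rpow_neg_one, le_div_iff₀ hZ0]
  linarith

theorem stmt_14 : ∃ C c : ℝ, 0 < C ∧ 0 < c ∧
    ∀ (n q : ℕ), 2 ≤ q → q % 2 = 0 → q ≤ n →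
      1 - (n : ℝ) ^ (-c) ≤
        tprob n q (fun A =>
          (∀ y : EuclideanSpace ℝ (Fin (q / 2) → Fin n), ‖y‖ = 1 →
            ∑ I, ∑ J, y I *
              ((∑ K ∈ Oset n q (fun v => cnt I v + cnt J v), A K) /
                ((Oset n q (fun v => cnt I v + cnt J v)).card : ℝ)) * y J ≤
              C ^ q * (n : ℝ) ^ ((q : ℝ) / 4) / (q : ℝ) ^ ((q : ℝ) / 4)) ∧
          (∀ x : EuclideanSpace ℝ (Fin n), ‖x‖ = 1 →
            ∑ K : Fin q → Fin n, A K * ∏ ℓ, x (K ℓ) ≤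
              C ^ q * (n : ℝ) ^ ((q : ℝ) / 4) / (q : ℝ) ^ ((q : ℝ) / 4))) := by
  refine ⟨12, 1, by norm_num, by norm_num, fun n q h2 hq hn => ?_⟩
  exact core n (q / 2) q (by omega) (by omega) hn
end
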